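/- arXiv:2111.10607 — 12 statements merged into one kernel-verified Lean document; each statement's English description precedes it below -/
import Mathlib

section
/- Let n ≥ 1 and let x : Fin n → ℝ satisfy x j ≥ 0 for all j and ∑_{j} x j ≤ 1. Then for every i ∈ Fin n, (1/2) · ( ∏_{j < i} (1 - x j) + ∑_{j < i} x j · ∏_{k < i, k ≠ j} (1 - x k) ) ≥ 1/e. (This quantity is the probability that element i is selected conditioned on i being active, under the single-item online scheme that with probability 1/2 accepts the first active element and with probability 1/2 accepts the second active element, when each element j is active independently with probability x j.) -/
/-- The one-variable inequality obtained by comparing a Bernoulli variable with a Poisson variable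
of the same mean. -/
theorem neg_le_mul_log_add_log_one_sub {x : ℝ} (hx0 : 0 ≤ x) (hx1 : x < 1) :
    -x ≤ x * Real.log ((1 + 1 / (1 - x)) / 2) + Real.log (1 - x) := by
  have hd : ∀ y ∈ Set.Ico (0 : ℝ) 1, HasDerivAt
      (fun y : ℝ => y * Real.log (1 - y / 2) + (1 - y) * Real.log (1 - y) + y)
      (Real.log (1 - y / 2) - Real.log (1 - y) - (y / 2) / (1 - y / 2)) y := by
    intro y hy
    have h1 : 1 - y / 2 ≠ 0 := by linarith [hy.2]
    have h2 : 1 - y ≠ 0 := by linarith [hy.2]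
    have d1 : HasDerivAt (fun y : ℝ => 1 - y / 2) (-(1 / 2)) y :=
      ((hasDerivAt_id' y).div_const 2).const_sub 1
    have d2 : HasDerivAt (fun y : ℝ => 1 - y) (-1) y := (hasDerivAt_id' y).const_sub 1
    refine ((((hasDerivAt_id' y).mul (d1.log h1)).add (d2.mul (d2.log h2))).add
      (hasDerivAt_id' y)).congr_deriv ?_
    rw [mul_div_cancel₀ _ h2]
    ring
  have hmono : MonotoneOn
      (fun y : ℝ => y * Real.log (1 - y / 2) + (1 - y) * Real.log (1 - y) + y)
      (Set.Ico 0 1) := by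
    refine monotoneOn_of_deriv_nonneg (convex_Ico 0 1)
      (fun y hy => (hd y hy).continuousAt.continuousWithinAt)
      (fun y hy => (hd y (interior_subset hy)).differentiableAt.differentiableWithinAt) ?_
    intro y hy
    have hy' := interior_subset hy
    rw [(hd y hy').deriv]
    have h1 : 0 < 1 - y / 2 := by linarith [hy'.2]
    have h2 : 0 < 1 - y := by linarith [hy'.2]
    have h := Real.one_sub_inv_le_log_of_pos (div_pos h1 h2)
    rw [Real.log_div h1.ne' h2.ne', inv_div] at h
    have e : (y / 2) / (1 - y / 2) = 1 - (1 - y) / (1 - y / 2) := by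
      rw [eq_sub_iff_add_eq, ← add_div, div_eq_one_iff_eq h1.ne']
      ring
    linarith
  have h := hmono (⟨le_rfl, one_pos⟩ : (0 : ℝ) ∈ Set.Ico (0 : ℝ) 1) ⟨hx0, hx1⟩ hx0
  have h1 : 0 < 1 - x / 2 := by linarith
  have h2 : 0 < 1 - x := by linarith
  have e : (1 + 1 / (1 - x)) / 2 = (1 - x / 2) / (1 - x) := by
    rw [eq_div_iff h2.ne', div_mul_eq_mul_div, add_mul, div_mul_cancel₀ _ h2.ne']
    ring
  rw [e, Real.log_div h1.ne' h2.ne']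
  simp at h
  linarith

/-- If independent events have probabilities summing to at most `1`, then at most one of them occurs
with probability at least `2 / e`. -/
theorem two_mul_exp_neg_one_le_prod_add_sum {ι : Type*} [DecidableEq ι] (s : Finset ι) (x : ι → ℝ)
    (hx : ∀ j ∈ s, 0 ≤ x j) (hsum : ∑ j ∈ s, x j ≤ 1) :
    2 * Real.exp (-1) ≤
      ∏ j ∈ s, (1 - x j) + ∑ j ∈ s, x j * ∏ k ∈ s.erase j, (1 - x k) := by
  have hle : ∀ j ∈ s, x j ≤ 1 := fun j hj => (Finset.single_le_sum hx hj).trans hsum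
  by_cases hone : ∃ j ∈ s, x j = 1
  · obtain ⟨j, hj, hj1⟩ := hone
    have hrest : ∀ k ∈ s.erase j, x k = 0 := by
      have hn : ∀ k ∈ s.erase j, 0 ≤ x k := fun k hk => hx k (Finset.mem_of_mem_erase hk)
      have := Finset.add_sum_erase s x hj
      exact (Finset.sum_eq_zero_iff_of_nonneg hn).1
        (le_antisymm (by linarith) (Finset.sum_nonneg hn))
    have hP : 0 ≤ ∏ k ∈ s, (1 - x k) :=
      Finset.prod_nonneg fun k hk => sub_nonneg.2 (hle k hk)
    have hQ := Finset.single_le_sum (f := fun j => x j * ∏ k ∈ s.erase j, (1 - x k))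
      (fun i hi => mul_nonneg (hx i hi) (Finset.prod_nonneg fun k hk =>
        sub_nonneg.2 (hle k (Finset.mem_of_mem_erase hk)))) hj
    have hprod : ∏ k ∈ s.erase j, (1 - x k) = 1 :=
      Finset.prod_eq_one fun k hk => by rw [hrest k hk, sub_zero]
    simp only [hj1, hprod, mul_one] at hQ
    have he : 2 * Real.exp (-1) ≤ 1 := by
      rw [Real.exp_neg, ← div_eq_mul_inv, div_le_one (Real.exp_pos 1)]
      linarith [Real.add_one_le_exp (1 : ℝ)]
    linarith
  · have hlt : ∀ j ∈ s, 0 < 1 - x j := fun j hj =>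
      sub_pos.2 (lt_of_le_of_ne (hle j hj) fun h => hone ⟨j, hj, h⟩)
    set P := ∏ j ∈ s, (1 - x j) with hP
    set c := (1 + ∑ j ∈ s, x j / (1 - x j)) / 2 with hc
    have hPpos : 0 < P := Finset.prod_pos hlt
    have hcpos : 0 < c := by
      have : 0 ≤ ∑ j ∈ s, x j / (1 - x j) :=
        Finset.sum_nonneg fun j hj => div_nonneg (hx j hj) (hlt j hj).le
      positivity
    have hQ : ∑ j ∈ s, x j * ∏ k ∈ s.erase j, (1 - x k) = P * ∑ j ∈ s, x j / (1 - x j) := by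
      rw [Finset.mul_sum]
      refine Finset.sum_congr rfl fun j hj => ?_
      have := (hlt j hj).ne'
      rw [hP, ← Finset.mul_prod_erase s _ hj]
      field_simp
    have htangent : ∀ z : ℝ, 0 < z → Real.log z ≤ z / c - 1 + Real.log c := by
      intro z hz
      have := Real.log_le_sub_one_of_pos (div_pos hz hcpos)
      rw [Real.log_div hz.ne' hcpos.ne'] at this
      linarith
    have hsumle : -∑ j ∈ s, x j ≤
        ∑ j ∈ s, (x j * (((1 + 1 / (1 - x j)) / 2) / c - 1 + Real.log c) + Real.log (1 - x j)) := by
      rw [← Finset.sum_neg_distrib]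
      refine Finset.sum_le_sum fun j hj => ?_
      have h1 := neg_le_mul_log_add_log_one_sub (hx j hj) (by linarith [hlt j hj])
      have hz : 0 < (1 + 1 / (1 - x j)) / 2 := by
        have := hlt j hj
        positivity
      have h2 := mul_le_mul_of_nonneg_left (htangent _ hz) (hx j hj)
      linarith
    have hexpand : ∑ j ∈ s,
        (x j * (((1 + 1 / (1 - x j)) / 2) / c - 1 + Real.log c) + Real.log (1 - x j)) =
        (∑ j ∈ s, x j + ∑ j ∈ s, x j / (1 - x j)) / (2 * c) +
          (∑ j ∈ s, x j) * (Real.log c - 1) + Real.log P := by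
      rw [hP, Real.log_prod fun j hj => (hlt j hj).ne', ← Finset.sum_add_distrib,
        Finset.sum_div, Finset.sum_mul, ← Finset.sum_add_distrib, ← Finset.sum_add_distrib]
      refine Finset.sum_congr rfl fun j hj => ?_
      ring_nf
    have hhalf : Real.log (1 / 2) ≤ 1 / 2 / c - 1 + Real.log c := htangent _ (by norm_num)
    have hlog2 : -1 ≤ Real.log (1 / 2) := by
      have := Real.one_sub_inv_le_log_of_pos (show (0 : ℝ) < 1 / 2 by norm_num)
      norm_num at this ⊢
      linarith
    have hslack := mul_le_mul_of_nonneg_left (hlog2.trans hhalf) (sub_nonneg.2 hsum)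
    have hmean : (∑ j ∈ s, x j + ∑ j ∈ s, x j / (1 - x j)) / (2 * c) +
        (1 - ∑ j ∈ s, x j) * (1 / 2 / c) = 1 := by
      have : ∑ j ∈ s, x j / (1 - x j) = 2 * c - 1 := by rw [hc]; ring
      rw [this]
      field_simp
      ring
    have hlog : -1 ≤ Real.log (P * c) := by
      rw [Real.log_mul hPpos.ne' hcpos.ne']
      linarith
    have hfin := (Real.le_log_iff_exp_le (mul_pos hPpos hcpos)).1 hlog
    rw [hQ]
    calc 2 * Real.exp (-1) ≤ 2 * (P * c) := by linarith
      _ = P + P * ∑ j ∈ s, x j / (1 - x j) := by rw [hc]; ring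

/-- The even mixture of the "accept first active" and "accept second active" schemes is
`1/e`-selectable for the single-item (rank-1 uniform matroid) setting: conditioned on
element `i` being active, it is selected with probability at least `1/e`. -/
theorem stmt0 (n : ℕ) (hn : 1 ≤ n) (x : Fin n → ℝ)
    (hx : ∀ j, 0 ≤ x j) (hsum : ∑ j, x j ≤ 1) (i : Fin n) :
    (1 / 2) * (∏ j ∈ Finset.Iio i, (1 - x j) +
      ∑ j ∈ Finset.Iio i, x j * ∏ k ∈ (Finset.Iio i).erase j, (1 - x k)) ≥
      1 / Real.exp 1 := by
  have h := two_mul_exp_neg_one_le_prod_add_sum (Finset.Iio i) x (fun j _ => hx j)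
    ((Finset.sum_le_univ_sum_of_nonneg hx).trans hsum)
  rw [Real.exp_neg] at h
  rw [one_div (Real.exp 1)]
  linarith
end

section
/- Let n ≥ 1 and let x : Fin n → ℝ satisfy x j ≥ 0 for all j and ∑_j x j ≤ 1. Define f_n(x) = ∏_{j} (1 - x j) + ∑_{j} x j · ∏_{k ≠ j} (1 - x k). Then f_n(x) ≥ (1 - 1/n)^n + (1 - 1/n)^{n-1}. -/
/-- The probability that at most one of the independent events indexed by `s` occurs, where event
`j` has probability `x j`. -/
noncomputable def probAtMostOne {ι : Type*} [DecidableEq ι] (s : Finset ι) (x : ι → ℝ) : ℝ :=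
  ∏ j ∈ s, (1 - x j) + ∑ j ∈ s, x j * ∏ k ∈ s.erase j, (1 - x k)

/-- The value of `probAtMostOne` for `n` events of probability `1 / n`. -/
noncomputable def uniformProb (n : ℕ) : ℝ :=
  (1 - 1 / (n : ℝ)) ^ n + (1 - 1 / (n : ℝ)) ^ (n - 1)

/-- A third-order refinement of Bernoulli's inequality. -/
theorem third_order_bernoulli (k : ℕ) {y : ℝ} (hy1 : y ≤ 1) :
    1 - k * y + k * (k - 1) / 2 * y ^ 2 - k * (k - 1) * (k - 2) / 6 * y ^ 3 ≤ (1 - y) ^ k := by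
  induction k with
  | zero => simp
  | succ k ih =>
    have hk : (0 : ℝ) ≤ k * (k - 1) * (k - 2) := by
      rcases k with _ | _ | k
      · simp
      · simp
      · push_cast
        have : (0 : ℝ) ≤ (k + 2) * (k + 1) * k := by positivity
        linarith
    have h := mul_le_mul_of_nonneg_right ih (sub_nonneg.2 hy1)
    have h4 : 0 ≤ k * (k - 1) * (k - 2) * y ^ 4 := mul_nonneg hk (by positivity)
    rw [pow_succ (1 - y)]
    push_cast
    linarith

theorem uniformProb_succ_le {m : ℕ} (hm : 1 ≤ m) : uniformProb (m + 1) ≤ uniformProb m := by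
  obtain ⟨k, rfl⟩ := Nat.exists_eq_add_of_le' hm
  have hm0 : (0 : ℝ) < k + 1 := by positivity
  have hm1 : (0 : ℝ) < k + 2 := by positivity
  have hb := third_order_bernoulli k (y := 1 / ((k : ℝ) + 1) ^ 2)
    (by rw [div_le_one (by positivity)]; nlinarith [(Nat.cast_nonneg k : (0 : ℝ) ≤ k)])
  have hleft : uniformProb (k + 1) = ((k : ℝ) / (k + 1)) ^ k * ((2 * k + 1) / (k + 1)) := by
    have : 1 - 1 / ((k : ℝ) + 1) = k / (k + 1) := by field_simp; ring
    simp only [uniformProb, Nat.add_sub_cancel, Nat.cast_add, Nat.cast_one, this, pow_succ]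
    field_simp
    ring
  have hright : uniformProb (k + 1 + 1) =
      (((k : ℝ) + 1) / (k + 2)) ^ k * ((k + 1) * (2 * k + 3) / (k + 2) ^ 2) := by
    have : 1 - 1 / ((k : ℝ) + 1 + 1) = (k + 1) / (k + 2) := by field_simp; ring
    simp only [uniformProb, Nat.add_sub_cancel, Nat.cast_add, Nat.cast_one, this, pow_succ]
    field_simp
    ring
  have hfactor : ((k : ℝ) / (k + 1)) ^ k =
      ((k + 1) / (k + 2)) ^ k * (1 - 1 / ((k : ℝ) + 1) ^ 2) ^ k := by
    rw [← mul_pow]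
    congr 1
    field_simp
    ring
  rw [hleft, hright, hfactor, mul_assoc]
  refine mul_le_mul_of_nonneg_left ?_ (by positivity)
  refine le_trans ?_ (mul_le_mul_of_nonneg_right hb (by positivity))
  rw [← sub_nonneg]
  have hpoly : (0 : ℝ) ≤ (k + 1) ^ 6 + 5 * (k + 1) ^ 4 - 11 * (k + 1) ^ 3 + 6 * (k + 1) ^ 2
      + 11 * (k + 1) - 6 := by
    ring_nf
    positivity
  refine le_of_le_of_eq (b := (((k : ℝ) + 1) ^ 6 + 5 * (k + 1) ^ 4 - 11 * (k + 1) ^ 3 + 6 * (k + 1) ^ 2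
      + 11 * (k + 1) - 6) / (6 * (k + 1) ^ 7 * (k + 2) ^ 2)) (by positivity) ?_
  field_simp
  ring

section Smoothing

variable {ι : Type*} [DecidableEq ι]

theorem probAtMostOne_insert {s : Finset ι} {i : ι} (hi : i ∉ s) (x : ι → ℝ) :
    probAtMostOne (insert i s) x =
      (1 - x i) * probAtMostOne s x + x i * ∏ k ∈ s, (1 - x k) := by
  have h : ∀ j ∈ s, x j * ∏ k ∈ (insert i s).erase j, (1 - x k) =
      (1 - x i) * (x j * ∏ k ∈ s.erase j, (1 - x k)) := by
    intro j hj
    have hij : i ≠ j := fun h => hi (h ▸ hj)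
    rw [Finset.erase_insert_of_ne hij, Finset.prod_insert (fun h => hi (Finset.mem_of_mem_erase h))]
    ring
  rw [probAtMostOne, Finset.prod_insert hi, Finset.sum_insert hi, Finset.erase_insert hi,
    Finset.sum_congr rfl h, ← Finset.mul_sum, probAtMostOne]
  ring

theorem probAtMostOne_congr {s : Finset ι} {x y : ι → ℝ} (h : ∀ j ∈ s, x j = y j) :
    probAtMostOne s x = probAtMostOne s y := by
  unfold probAtMostOne
  congr 1
  · exact Finset.prod_congr rfl fun j hj => by rw [h j hj]
  · refine Finset.sum_congr rfl fun j hj => ?_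
    rw [h j hj]
    congr 1
    exact Finset.prod_congr rfl fun k hk => by rw [h k (Finset.mem_of_mem_erase hk)]

theorem probAtMostOne_const (s : Finset ι) (c : ℝ) :
    probAtMostOne s (fun _ => c) = (1 - c) ^ s.card + s.card * (c * (1 - c) ^ (s.card - 1)) := by
  unfold probAtMostOne
  rw [Finset.prod_const, Finset.sum_congr rfl fun j hj => by
    rw [Finset.prod_const, Finset.card_erase_of_mem hj], Finset.sum_const, nsmul_eq_mul]

/-- For two of the events, `probAtMostOne` depends on their probabilities only through the sum and
(affinely) the product. -/
theorem probAtMostOne_insert_insert {s : Finset ι} {i j : ι} (hij : i ≠ j) (hi : i ∉ s)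
    (hj : j ∉ s) (x : ι → ℝ) :
    probAtMostOne (insert i (insert j s)) x =
      (1 - (x i + x j)) * (probAtMostOne s x - ∏ k ∈ s, (1 - x k)) + ∏ k ∈ s, (1 - x k) +
      x i * x j * (probAtMostOne s x - 2 * ∏ k ∈ s, (1 - x k)) := by
  rw [probAtMostOne_insert (by simp [hij, hi]), probAtMostOne_insert hj, Finset.prod_insert hj]
  ring

theorem uniformProb_le_probAtMostOne (s : Finset ι) (x : ι → ℝ) (hx : ∀ j ∈ s, 0 ≤ x j)
    (hsum : ∑ j ∈ s, x j = 1) : uniformProb s.card ≤ probAtMostOne s x := by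
  induction hn : s.card using Nat.strong_induction_on generalizing s x with
  | _ n ihn =>
  have hzero : ∀ y : ι → ℝ, (∀ j ∈ s, 0 ≤ y j) → ∑ j ∈ s, y j = 1 → (∃ i ∈ s, y i = 0) →
      uniformProb n ≤ probAtMostOne s y := by
    rintro y hy hysum ⟨i, his, hi⟩
    have hsum' : ∑ j ∈ s.erase i, y j = 1 := by
      rw [← Finset.add_sum_erase s y his, hi, zero_add] at hysum
      exact hysum
    have hcard := Finset.card_erase_add_one his
    have hpos : 1 ≤ (s.erase i).card := by
      rw [Nat.one_le_iff_ne_zero, Ne, Finset.card_eq_zero]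
      intro h
      simp [h] at hsum'
    have h1 := ihn _ (by omega) (s.erase i) y (fun j hj => hy j (Finset.mem_of_mem_erase hj))
      hsum' rfl
    have h2 := uniformProb_succ_le hpos
    rw [hcard, hn] at h2
    rw [← Finset.insert_erase his, probAtMostOne_insert (Finset.notMem_erase i s), hi]
    linarith
  have hs : s.Nonempty := by
    rw [Finset.nonempty_iff_ne_empty]
    rintro rfl
    simp at hsum
  have hn0 : (0 : ℝ) < n := by
    rw [← hn]
    exact_mod_cast hs.card_pos
  have hconst : ∑ _j ∈ s, (1 / (n : ℝ)) = 1 := by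
    rw [Finset.sum_const, hn, nsmul_eq_mul]
    field_simp
  clear ihn
  -- Induct on the number of coordinates that differ from `1 / n`.
  induction hd : (s.filter fun j => x j ≠ 1 / (n : ℝ)).card using Nat.strong_induction_on
    generalizing x with
  | _ d ihd =>
  by_cases hall : ∀ j ∈ s, x j = 1 / (n : ℝ)
  · rw [probAtMostOne_congr hall, probAtMostOne_const, hn, uniformProb]
    apply le_of_eq
    field_simp
  push Not at hall
  obtain ⟨l, hls, hl⟩ := hall
  obtain ⟨i, his, hi⟩ : ∃ i ∈ s, x i < 1 / (n : ℝ) := by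
    by_contra! h
    exact hl ((Finset.sum_eq_sum_iff_of_le h).1 (hconst.trans hsum.symm) l hls).symm
  obtain ⟨j, hjs, hj⟩ : ∃ j ∈ s, 1 / (n : ℝ) < x j := by
    by_contra! h
    exact hl ((Finset.sum_eq_sum_iff_of_le h).1 (hsum.trans hconst.symm) l hls)
  have hij : i ≠ j := by
    rintro rfl
    exact lt_asymm hi hj
  obtain ⟨t, hit, hjt, rfl⟩ : ∃ t : Finset ι, i ∉ t ∧ j ∉ t ∧ s = insert i (insert j t) := by
    refine ⟨(s.erase i).erase j, by simp, by simp, ?_⟩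
    rw [Finset.insert_erase (by simp [hjs, hij.symm]), Finset.insert_erase his]
  have hijt : i ∉ insert j t := by simp [hij, hit]
  -- Moving mass between `i` and `j` while keeping the sum fixed.
  let z : ℝ → ι → ℝ := fun a k => if k = i then a else if k = j then x i + x j - a else x k
  have hzi : ∀ a, z a i = a := fun a => by simp [z]
  have hzj : ∀ a, z a j = x i + x j - a := fun a => by simp [z, hij.symm]
  have hzt : ∀ a, ∀ k ∈ t, z a k = x k := fun a k hk => by
    have h1 : k ≠ i := fun h => hit (h ▸ hk)
    have h2 : k ≠ j := fun h => hjt (h ▸ hk)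
    simp [z, h1, h2]
  have hznonneg : ∀ a, 0 ≤ a → a ≤ x i + x j → ∀ k ∈ insert i (insert j t), 0 ≤ z a k := by
    intro a ha ha' k hk
    rcases Finset.mem_insert.1 hk with rfl | hk'
    · rwa [hzi]
    rcases Finset.mem_insert.1 hk' with rfl | hk'
    · rw [hzj]
      linarith
    · rw [hzt a k hk']
      exact hx k hk
  have hzsum : ∀ a, ∑ k ∈ insert i (insert j t), z a k = 1 := by
    intro a
    rw [Finset.sum_insert hijt, Finset.sum_insert hjt, hzi, hzj, Finset.sum_congr rfl (hzt a),
      ← hsum, Finset.sum_insert hijt, Finset.sum_insert hjt]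
    ring
  have hzprob : ∀ a, probAtMostOne (insert i (insert j t)) (z a) =
      probAtMostOne (insert i (insert j t)) x + (a * (x i + x j - a) - x i * x j) *
        (probAtMostOne t x - 2 * ∏ k ∈ t, (1 - x k)) := by
    intro a
    rw [probAtMostOne_insert_insert hij hit hjt, probAtMostOne_insert_insert hij hit hjt, hzi, hzj,
      probAtMostOne_congr (hzt a), Finset.prod_congr rfl fun k hk => by rw [hzt a k hk]]
    ring
  have hxi := hx i his
  have hxj := hx j hjs
  rcases le_total 0 (probAtMostOne t x - 2 * ∏ k ∈ t, (1 - x k)) with hc | hc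
  · have h := hzero (z 0) (hznonneg 0 le_rfl (by linarith)) (hzsum 0) ⟨i, his, hzi 0⟩
    rw [hzprob] at h
    have := mul_nonneg (mul_nonneg hxi hxj) hc
    linarith
  · have h := ihd _ ?_ (z (1 / n)) (hznonneg _ (by positivity) (by linarith)) (hzsum _) rfl
    · rw [hzprob] at h
      have hp : 0 ≤ 1 / (n : ℝ) * (x i + x j - 1 / n) - x i * x j := by
        have := mul_nonneg (sub_nonneg.2 hi.le) (sub_nonneg.2 hj.le)
        linarith
      have := mul_nonpos_of_nonneg_of_nonpos hp hc
      linarith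
    · rw [← hd]
      refine Finset.card_lt_card (Finset.ssubset_iff_subset_ne.2 ⟨?_, ?_⟩)
      · intro k hk
        rw [Finset.mem_filter] at hk ⊢
        refine ⟨hk.1, ?_⟩
        rcases Finset.mem_insert.1 hk.1 with rfl | hk'
        · exact hi.ne
        rcases Finset.mem_insert.1 hk' with rfl | hk'
        · exact hj.ne'
        · rw [← hzt (1 / n) k hk']
          exact hk.2
      · intro h
        have hmem : i ∈ (insert i (insert j t)).filter fun k => x k ≠ 1 / (n : ℝ) :=
          Finset.mem_filter.2 ⟨his, hi.ne⟩
        rw [← h, Finset.mem_filter] at hmem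
        exact hmem.2 (hzi _)

end Smoothing

/-- For `x ∈ ℝ^n` nonnegative with `∑ x ≤ 1`, the probability that at most one of `n`
independent events (event `j` having probability `x j`) occurs is at least
`(1 - 1/n)^n + (1 - 1/n)^(n-1)`. -/
theorem stmt1 (n : ℕ) (hn : 1 ≤ n) (x : Fin n → ℝ)
    (hx : ∀ j, 0 ≤ x j) (hsum : ∑ j, x j ≤ 1) :
    ∏ j, (1 - x j) + ∑ j, x j * ∏ k ∈ Finset.univ.erase j, (1 - x k) ≥
      (1 - 1 / (n : ℝ)) ^ n + (1 - 1 / (n : ℝ)) ^ (n - 1) := by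
  let i : Fin n := ⟨0, hn⟩
  let t : Finset (Fin n) := Finset.univ.erase i
  have hit : i ∉ t := Finset.notMem_erase i _
  have huniv : (Finset.univ : Finset (Fin n)) = insert i t :=
    (Finset.insert_erase (Finset.mem_univ i)).symm
  have hxi := hx i
  have hx1 : ∀ k, x k ≤ 1 := fun k =>
    (Finset.single_le_sum (fun j _ => hx j) (Finset.mem_univ k)).trans hsum
  -- Raise the probability of one event until the sum is `1`.
  let z : Fin n → ℝ := Function.update x i (1 - ∑ k ∈ t, x k)
  have hzi : z i = 1 - ∑ k ∈ t, x k := Function.update_self ..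
  have hzt : ∀ k ∈ t, z k = x k := fun k hk =>
    Function.update_of_ne (Finset.ne_of_mem_erase hk) _ _
  rw [huniv, Finset.sum_insert hit] at hsum
  have h := uniformProb_le_probAtMostOne Finset.univ z
    (by
      intro k _
      by_cases hk : k = i
      · rw [hk, hzi]
        linarith
      · rw [hzt k (Finset.mem_erase.2 ⟨hk, Finset.mem_univ k⟩)]
        exact hx k)
    (by
      rw [huniv, Finset.sum_insert hit, hzi, Finset.sum_congr rfl hzt]
      ring)
  have hle : probAtMostOne Finset.univ z ≤ probAtMostOne Finset.univ x := by
    have hsum_nonneg : 0 ≤ ∑ j ∈ t, x j * ∏ k ∈ t.erase j, (1 - x k) :=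
      Finset.sum_nonneg fun j _ => mul_nonneg (hx j)
        (Finset.prod_nonneg fun k _ => sub_nonneg.2 (hx1 k))
    have hmul := mul_nonneg (sub_nonneg.2 (show x i ≤ z i by rw [hzi]; linarith)) hsum_nonneg
    rw [huniv, probAtMostOne_insert hit, probAtMostOne_insert hit, probAtMostOne_congr hzt,
      Finset.prod_congr rfl fun k hk => by rw [hzt k hk], probAtMostOne]
    linarith
  rw [Finset.card_univ, Fintype.card_fin] at h
  exact h.trans hle
end

section
/- The sequence a_n = (1 - 1/n)^n + (1 - 1/n)^{n-1}, defined for integers n ≥ 1, is monotonically decreasing in n. -/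
/-- The cubic Bonferroni-type truncation of the binomial expansion bounds `(1 - x) ^ n` from
below on `[0, 1]`. -/
theorem one_sub_pow_ge_cubic {x : ℝ} (hx : 0 ≤ x) (hx1 : x ≤ 1) (n : ℕ) :
    1 - n * x + n * (n - 1) / 2 * x ^ 2 - n * (n - 1) * (n - 2) / 6 * x ^ 3 ≤ (1 - x) ^ n := by
  induction n with
  | zero => simp
  | succ k ih =>
    have hk : (0 : ℝ) ≤ k * (k - 1) * (k - 2) := by
      rcases k with _ | _ | k
      · simp
      · simp
      · push_cast
        have h : ((k : ℝ) + 1 + 1) * (k + 1 + 1 - 1) * (k + 1 + 1 - 2) =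
          (k + 2) * (k + 1) * k := by ring
        rw [h]
        positivity
    have h := mul_le_mul_of_nonneg_right ih (sub_nonneg.2 hx1)
    have h4 := mul_nonneg hk (pow_nonneg hx 4)
    rw [pow_succ]
    refine le_trans ?_ h
    push_cast
    linarith

/-- The sequence `a n = (1 - 1/n)^n + (1 - 1/n)^(n-1)` (for `n ≥ 1`) is monotonically
decreasing: `a (n+1) ≤ a n`. -/
theorem stmt2 (n : ℕ) (hn : 1 ≤ n) :
    (1 - 1 / ((n : ℝ) + 1)) ^ (n + 1) + (1 - 1 / ((n : ℝ) + 1)) ^ n ≤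
      (1 - 1 / (n : ℝ)) ^ n + (1 - 1 / (n : ℝ)) ^ (n - 1) := by
  rcases hn.eq_or_lt with rfl | hn
  · norm_num
  have hn2 : (2 : ℝ) ≤ n := by exact_mod_cast hn
  have hn0 : (0 : ℝ) < n := by linarith
  set r : ℝ := 1 - 1 / (n : ℝ) with hr
  set s : ℝ := 1 - 1 / ((n : ℝ) + 1) with hs
  set y : ℝ := 1 - 1 / (n : ℝ) ^ 2 with hy
  have hr0 : 0 < r := by
    rw [hr, sub_pos, div_lt_one hn0]
    linarith
  have hs0 : 0 ≤ s := by
    rw [hs, sub_nonneg, div_le_one (by positivity)]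
    linarith
  have hrys : r = y * s := by
    rw [hr, hs, hy]
    field_simp
    ring
  have hpow : r ^ n = r ^ (n - 1) * r := by
    rw [← pow_succ, Nat.sub_add_cancel (by omega)]
  have key : r * (s + 1) ≤ y ^ n * (r + 1) := by
    have hx1 : 1 / (n : ℝ) ^ 2 ≤ 1 := by
      rw [div_le_one (by positivity)]
      nlinarith
    have hcubic := one_sub_pow_ge_cubic (by positivity) hx1 n
    refine le_trans ?_ (mul_le_mul_of_nonneg_right hcubic (by linarith))
    rw [← sub_nonneg]
    have hdiff : (1 - n * (1 / (n : ℝ) ^ 2) + n * (n - 1) / 2 * (1 / (n : ℝ) ^ 2) ^ 2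
        - n * (n - 1) * (n - 2) / 6 * (1 / (n : ℝ) ^ 2) ^ 3) * (r + 1) - r * (s + 1)
        = ((n : ℝ) - 1) * (n ^ 3 + 3 * n - 2) / (6 * n ^ 6 * (n + 1)) := by
      rw [hr, hs]
      field_simp
      ring
    rw [hdiff]
    exact div_nonneg (mul_nonneg (by linarith) (by nlinarith [pow_pos hn0 3])) (by positivity)
  have hmul : r * (s ^ (n + 1) + s ^ n) ≤ r * (r ^ n + r ^ (n - 1)) := by
    calc r * (s ^ (n + 1) + s ^ n) = s ^ n * (r * (s + 1)) := by ring
      _ ≤ s ^ n * (y ^ n * (r + 1)) := mul_le_mul_of_nonneg_left key (pow_nonneg hs0 n)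
      _ = (y * s) ^ n * (r + 1) := by rw [mul_pow]; ring
      _ = r ^ n * (r + 1) := by rw [← hrys]
      _ = r * (r ^ n + r ^ (n - 1)) := by rw [hpow]; ring
  exact le_of_mul_le_mul_left hmul hr0
end

section
/- For every ε > 0 there exists n₀ such that for all integers n ≥ n₀ and all k with 0 ≤ k ≤ n − 1, the binomial probability q_k = C(n−1, k) · (1/n)^k · (1 − 1/n)^{n−1−k} satisfies q_k ≤ 1/e + ε. -/
/-- The `Binomial(m, p)` mass at `k` is at most the mass at `0` when `m * p ≤ 1 - p`. -/
theorem choose_mul_pow_mul_pow_le {m k : ℕ} (hk : k ≤ m) {p : ℝ} (hp : 0 ≤ p) (hp1 : p ≤ 1)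
    (hmp : m * p ≤ 1 - p) :
    (m.choose k : ℝ) * p ^ k * (1 - p) ^ (m - k) ≤ (1 - p) ^ m := by
  have hq : 0 ≤ 1 - p := sub_nonneg.mpr hp1
  have hc : (m.choose k : ℝ) ≤ (m : ℝ) ^ k := mod_cast Nat.choose_le_pow m k
  calc (m.choose k : ℝ) * p ^ k * (1 - p) ^ (m - k)
      ≤ (m : ℝ) ^ k * p ^ k * (1 - p) ^ (m - k) := by gcongr
    _ = (m * p) ^ k * (1 - p) ^ (m - k) := by rw [mul_pow]
    _ ≤ (1 - p) ^ k * (1 - p) ^ (m - k) := by gcongr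
    _ = (1 - p) ^ m := by rw [← pow_add, Nat.add_sub_cancel' hk]

theorem tendsto_one_sub_one_div_succ_pow :
    Filter.Tendsto (fun m : ℕ => (1 - 1 / ((m + 1 : ℕ) : ℝ)) ^ m) Filter.atTop
      (nhds (1 / Real.exp 1)) := by
  have h := (Real.tendsto_one_add_div_pow_exp 1).inv₀ (Real.exp_ne_zero 1)
  rw [← one_div] at h
  refine h.congr' ?_
  filter_upwards [Filter.eventually_gt_atTop 0] with m hm
  have hm' : (m : ℝ) ≠ 0 := by positivity
  rw [← inv_pow]
  congr 1
  push_cast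
  field_simp
  ring

/-- For every `ε > 0` there is `n₀` such that for all `n ≥ n₀` and all `0 ≤ k ≤ n - 1`,
the binomial probability `q k = C(n-1, k) (1/n)^k (1 - 1/n)^(n-1-k)` is at most `1/e + ε`. -/
theorem stmt4 (ε : ℝ) (hε : 0 < ε) :
    ∃ n₀ : ℕ, ∀ n : ℕ, n₀ ≤ n → ∀ k : ℕ, k ≤ n - 1 →
      ((n - 1).choose k : ℝ) * (1 / (n : ℝ)) ^ k * (1 - 1 / (n : ℝ)) ^ (n - 1 - k) ≤
        1 / Real.exp 1 + ε := by
  obtain ⟨N, hN⟩ := Filter.eventually_atTop.mp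
    (tendsto_one_sub_one_div_succ_pow.eventually_le_const (lt_add_of_pos_right _ hε))
  refine ⟨N + 1, fun n hn k hk => ?_⟩
  obtain ⟨m, rfl⟩ : ∃ m, n = m + 1 := ⟨n - 1, by omega⟩
  rw [Nat.add_sub_cancel] at hk ⊢
  refine (choose_mul_pow_mul_pow_le hk (by positivity) ?_ ?_).trans (hN m (by omega))
  · rw [div_le_one (by positivity)]
    exact_mod_cast Nat.le_add_left 1 m
  · apply le_of_eq
    push_cast
    field_simp
    ring
end

section
/- For every ε > 0 there exists n₀ such that for every integer n ≥ n₀ and every sequence p : ℕ → ℝ with 0 ≤ p k ≤ 1 for all k, one has ∑_{k=1}^{n} q_{k-1} · ( ∏_{i=1}^{k-1} (1 - p i) ) · p k ≤ 1/e + ε, where q_k = C(n−1, k) · (1/n)^k · (1 − 1/n)^{n−1−k}. (This is the probability that a counting-based strategy, which accepts the k-th active element with probability p k, selects the last element of the uniform instance x_i = 1/n conditioned on that element being active.) -/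
/-- The probabilities that a sequential trial stops at step `k ≤ n`, or never, add up to `1`. -/
theorem sum_prod_one_sub_mul_add_prod {R : Type*} [CommRing R] (p : ℕ → R) (n : ℕ) :
    ∑ k ∈ Finset.Icc 1 n, (∏ i ∈ Finset.Icc 1 (k - 1), (1 - p i)) * p k +
      ∏ i ∈ Finset.Icc 1 n, (1 - p i) = 1 := by
  induction n with
  | zero => simp
  | succ n ih =>
    rw [Finset.sum_Icc_succ_top (by omega), Finset.prod_Icc_succ_top (by omega),
      Nat.add_sub_cancel]
    linear_combination ih

/-- The mode of the binomial distribution with parameters `n - 1` and `1 / n` is `0`. -/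
theorem choose_mul_pow_mul_pow_le_s5 {n k : ℕ} (hn : 1 ≤ n) (hk : k ≤ n - 1) :
    ((n - 1).choose k : ℝ) * (1 / (n : ℝ)) ^ k * (1 - 1 / (n : ℝ)) ^ (n - 1 - k) ≤
      (1 - 1 / (n : ℝ)) ^ (n - 1) := by
  have hn' : (1 : ℝ) ≤ n := by exact_mod_cast hn
  have h0 : (0 : ℝ) ≤ 1 - 1 / n := sub_nonneg.2 (div_le_one_of_le₀ hn' (by positivity))
  have hc : ((n - 1).choose k : ℝ) ≤ ((n : ℝ) - 1) ^ k := by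
    have h : (((n - 1).choose k : ℕ) : ℝ) ≤ (((n - 1) ^ k : ℕ) : ℝ) :=
      Nat.cast_le.2 (Nat.choose_le_pow _ _)
    rwa [Nat.cast_pow, Nat.cast_sub hn, Nat.cast_one] at h
  calc ((n - 1).choose k : ℝ) * (1 / (n : ℝ)) ^ k * (1 - 1 / (n : ℝ)) ^ (n - 1 - k)
      ≤ ((n : ℝ) - 1) ^ k * (1 / (n : ℝ)) ^ k * (1 - 1 / (n : ℝ)) ^ (n - 1 - k) := by gcongr
    _ = (1 - 1 / (n : ℝ)) ^ k * (1 - 1 / (n : ℝ)) ^ (n - 1 - k) := by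
        rw [← mul_pow]
        congr 2
        field_simp
    _ = (1 - 1 / (n : ℝ)) ^ (n - 1) := by rw [← pow_add, Nat.add_sub_cancel' hk]

open Filter Topology in
theorem tendsto_one_sub_one_div_pow_pred :
    Tendsto (fun n : ℕ => (1 - 1 / (n : ℝ)) ^ (n - 1)) atTop (𝓝 (1 / Real.exp 1)) := by
  have h1 : Tendsto (fun n : ℕ => 1 - 1 / (n : ℝ)) atTop (𝓝 1) := by
    simpa using (tendsto_const_nhds (x := (1 : ℝ))).sub tendsto_one_div_atTop_nhds_zero_nat
  have h2 := (Real.tendsto_one_add_div_pow_exp (-1)).div h1 one_ne_zero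
  rw [div_one, Real.exp_neg, ← one_div] at h2
  refine h2.congr' ?_
  filter_upwards [eventually_ge_atTop 2] with n hn
  have hn' : (2 : ℝ) ≤ n := by exact_mod_cast hn
  have hne : 1 - 1 / (n : ℝ) ≠ 0 :=
    sub_ne_zero.2 ((div_lt_one (by linarith)).2 (by linarith)).ne'
  obtain ⟨m, rfl⟩ : ∃ m, n = m + 1 := ⟨n - 1, by omega⟩
  rw [Pi.div_apply, neg_div, ← sub_eq_add_neg, Nat.add_sub_cancel, pow_succ,
    mul_div_cancel_right₀ _ hne]

/-- No counting-based strategy is better than `(1/e + ε)`-selectable on the uniform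
single-item instance `x i = 1/n` for large `n`: the probability that the strategy with
acceptance probabilities `p` selects the last element, conditioned on it being active,
namely `∑_{k=1}^n q_{k-1} (∏_{i=1}^{k-1} (1 - p i)) p k` with
`q k = C(n-1,k) (1/n)^k (1-1/n)^(n-1-k)`, is at most `1/e + ε`. -/
theorem stmt5 (ε : ℝ) (hε : 0 < ε) :
    ∃ n₀ : ℕ, ∀ n : ℕ, n₀ ≤ n → ∀ p : ℕ → ℝ, (∀ k, 0 ≤ p k ∧ p k ≤ 1) →
      ∑ k ∈ Finset.Icc 1 n,
          (((n - 1).choose (k - 1) : ℝ) * (1 / (n : ℝ)) ^ (k - 1) *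
              (1 - 1 / (n : ℝ)) ^ (n - 1 - (k - 1))) *
            (∏ i ∈ Finset.Icc 1 (k - 1), (1 - p i)) * p k ≤
        1 / Real.exp 1 + ε := by
  obtain ⟨N, hN⟩ := Filter.eventually_atTop.1
    (tendsto_one_sub_one_div_pow_pred.eventually_le_const (lt_add_of_pos_right _ hε))
  refine ⟨max N 1, fun n hn p hp => ?_⟩
  have hn1 : 1 ≤ n := le_of_max_le_right hn
  have hprod (m : ℕ) : 0 ≤ ∏ i ∈ Finset.Icc 1 m, (1 - p i) :=
    Finset.prod_nonneg fun i _ => sub_nonneg.2 (hp i).2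
  have h0 : (0 : ℝ) ≤ 1 - 1 / n :=
    sub_nonneg.2 (div_le_one_of_le₀ (by exact_mod_cast hn1) (by positivity))
  refine le_trans ?_ (hN n (le_of_max_le_left hn))
  calc _ ≤ ∑ k ∈ Finset.Icc 1 n, (1 - 1 / (n : ℝ)) ^ (n - 1) *
          ((∏ i ∈ Finset.Icc 1 (k - 1), (1 - p i)) * p k) := by
        refine Finset.sum_le_sum fun k hk => ?_
        rw [mul_assoc _ (∏ i ∈ Finset.Icc 1 (k - 1), (1 - p i))]
        exact mul_le_mul_of_nonneg_right
          (choose_mul_pow_mul_pow_le_s5 hn1 (Nat.sub_le_sub_right (Finset.mem_Icc.1 hk).2 1))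
          (mul_nonneg (hprod _) (hp k).1)
    _ ≤ (1 - 1 / (n : ℝ)) ^ (n - 1) := by
        rw [← Finset.mul_sum]
        refine mul_le_of_le_one_right (pow_nonneg h0 _) ?_
        linarith [sum_prod_one_sub_mul_add_prod p n, hprod n]
end

section
/- For all positive integers n and m and every ε > 0, there exists a positive integer N with the following property: for every function f : Finset (Fin N) → ℝ with 0 ≤ f T ≤ 1 for all T, there exist a subset S of Fin N with |S| = m and a sequence p : ℕ → ℝ such that for every nonempty T ⊆ S with |T| ≤ n, one has p(|T|) ≤ f T ≤ p(|T|) + ε. -/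
/-- From the Ramsey property for `r`-subsets: every large enough finite set contains a subset of
size `t` in which the color of an `(r + 1)`-subset depends only on its least element. -/
theorem exists_color_eq_of_min {α κ : Type*} [LinearOrder α] {r : ℕ}
    (ramsey : ∀ m : ℕ, ∃ N : ℕ, ∀ A : Finset α, N ≤ A.card → ∀ c : Finset α → κ,
      ∃ S ⊆ A, S.card = m ∧ ∃ d, ∀ T ⊆ S, T.card = r → c T = d) (t : ℕ) :
    ∃ N : ℕ, ∀ A : Finset α, N ≤ A.card → ∀ c : Finset α → κ,
      ∃ S ⊆ A, S.card = t ∧ ∃ g : α → κ, ∀ x ∈ S, ∀ T ⊆ S, (∀ y ∈ T, x < y) →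
        T.card = r → c (insert x T) = g x := by
  induction t with
  | zero => exact ⟨0, fun A _ c => ⟨∅, by simp, rfl, fun _ => c ∅, by simp⟩⟩
  | succ t ih =>
    obtain ⟨N₁, h₁⟩ := ih
    obtain ⟨N₂, h₂⟩ := ramsey N₁
    refine ⟨N₂ + 1, fun A hA c => ?_⟩
    have hne : A.Nonempty := Finset.card_pos.mp (by omega)
    set a := A.min' hne
    have ha : a ∈ A := A.min'_mem hne
    obtain ⟨B, hBA, hB, d, hd⟩ := h₂ (A.erase a)
      (by rw [Finset.card_erase_of_mem ha]; omega) (fun T => c (insert a T))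
    obtain ⟨S, hSB, hS, g, hg⟩ := h₁ B hB.ge c
    have hlt : ∀ y ∈ S, a < y := fun y hy => A.min'_lt_of_mem_erase_min' hne (hBA (hSB hy))
    have haS : a ∉ S := fun h => lt_irrefl a (hlt a h)
    refine ⟨insert a S, ?_, by rw [Finset.card_insert_of_notMem haS, hS],
      Function.update g a d, fun x hx T hT hxT hTr => ?_⟩
    · exact Finset.insert_subset ha (hSB.trans (hBA.trans (Finset.erase_subset _ _)))
    · have hax : a ≤ x := by
        rcases Finset.mem_insert.mp hx with rfl | h
        exacts [le_rfl, (hlt x h).le]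
      have hTS : T ⊆ S := fun y hy => (Finset.mem_insert.mp (hT hy)).resolve_left
        (hax.trans_lt (hxT y hy)).ne'
      rcases Finset.mem_insert.mp hx with rfl | h
      · rw [Function.update_self]
        exact hd T (hTS.trans hSB) hTr
      · rw [Function.update_of_ne (hlt x h).ne']
        exact hg x h T hTS hxT hTr

/-- The finite hypergraph Ramsey theorem. -/
theorem hypergraph_ramsey (α κ : Type*) [LinearOrder α] [Fintype κ] (r m : ℕ) :
    ∃ N : ℕ, ∀ A : Finset α, N ≤ A.card → ∀ c : Finset α → κ,
      ∃ S ⊆ A, S.card = m ∧ ∃ d, ∀ T ⊆ S, T.card = r → c T = d := by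
  classical
  induction r generalizing m with
  | zero =>
    refine ⟨m, fun A hA c => ?_⟩
    obtain ⟨S, hSA, hS⟩ := Finset.exists_subset_card_eq hA
    refine ⟨S, hSA, hS, c ∅, fun T _ hT => ?_⟩
    rw [Finset.card_eq_zero.mp hT]
  | succ r ih =>
    obtain ⟨N, hN⟩ := exists_color_eq_of_min ih (Fintype.card κ * m)
    refine ⟨N, fun A hA c => ?_⟩
    obtain ⟨S, hSA, hS, g, hg⟩ := hN A hA c
    have : Nonempty κ := ⟨c ∅⟩
    obtain ⟨d, -, hd⟩ := Finset.exists_le_card_fiber_of_mul_le_card_of_maps_to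
      (s := S) (t := Finset.univ) (f := g) (n := m) (fun _ _ => Finset.mem_univ _)
      Finset.univ_nonempty (by rw [Finset.card_univ, hS])
    obtain ⟨R, hRS, hR⟩ := Finset.exists_subset_card_eq hd
    have hR' : R ⊆ S := hRS.trans (Finset.filter_subset _ _)
    refine ⟨R, hR'.trans hSA, hR, d, fun T hTR hT => ?_⟩
    have hne : T.Nonempty := Finset.card_pos.mp (by omega)
    have hmem := T.min'_mem hne
    rw [← Finset.insert_erase hmem, hg _ (hR' (hTR hmem)) _
      ((Finset.erase_subset _ _).trans (hTR.trans hR'))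
      (fun y hy => T.min'_lt_of_mem_erase_min' hne hy)
      (by rw [Finset.card_erase_of_mem hmem]; omega)]
    exact (Finset.mem_filter.mp (hRS (hTR hmem))).2

/-- Ramsey's theorem simultaneously for all uniformities up to `n`. -/
theorem hypergraph_ramsey_card_le (α κ : Type*) [LinearOrder α] [Fintype κ] (n m : ℕ) :
    ∃ N : ℕ, ∀ A : Finset α, N ≤ A.card → ∀ c : Finset α → κ,
      ∃ S ⊆ A, S.card = m ∧ ∃ d : ℕ → κ, ∀ T ⊆ S, T.card ≤ n → c T = d T.card := by
  induction n generalizing m with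
  | zero =>
    obtain ⟨N, hN⟩ := hypergraph_ramsey α κ 0 m
    refine ⟨N, fun A hA c => ?_⟩
    obtain ⟨S, hSA, hS, d, hd⟩ := hN A hA c
    exact ⟨S, hSA, hS, fun _ => d, fun T hT h => hd T hT (Nat.le_zero.mp h)⟩
  | succ n ih =>
    obtain ⟨N₁, h₁⟩ := hypergraph_ramsey α κ (n + 1) m
    obtain ⟨N₂, h₂⟩ := ih N₁
    refine ⟨N₂, fun A hA c => ?_⟩
    obtain ⟨B, hBA, hB, d, hd⟩ := h₂ A hA c
    obtain ⟨S, hSB, hS, e, he⟩ := h₁ B hB.ge c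
    refine ⟨S, hSB.trans hBA, hS, Function.update d (n + 1) e, fun T hT h => ?_⟩
    rcases h.eq_or_lt with h | h
    · rw [h, Function.update_self]
      exact he T hT h
    · rw [Function.update_of_ne h.ne]
      exact hd T (hT.trans hSB) (Nat.le_of_lt_succ h)

/-- For all `n, m ≥ 1` and `ε > 0`, there is `N` such that every oblivious single-item
OCRS on ground set `Fin N` (described by `f : Finset (Fin N) → [0,1]`) is
`(ε, n)`-approximate to a counting-based strategy `p` on some subset `S` of size `m`:
for every nonempty `T ⊆ S` with `|T| ≤ n`, `p |T| ≤ f T ≤ p |T| + ε`. -/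
theorem stmt6 (n m : ℕ) (hn : 0 < n) (hm : 0 < m) (ε : ℝ) (hε : 0 < ε) :
    ∃ N : ℕ, 0 < N ∧ ∀ f : Finset (Fin N) → ℝ, (∀ T, 0 ≤ f T ∧ f T ≤ 1) →
      ∃ S : Finset (Fin N), S.card = m ∧ ∃ p : ℕ → ℝ,
        ∀ T : Finset (Fin N), T ⊆ S → T.Nonempty → T.card ≤ n →
          p T.card ≤ f T ∧ f T ≤ p T.card + ε := by
  obtain ⟨N, hN⟩ := hypergraph_ramsey_card_le ℕ (Fin (⌊1 / ε⌋₊ + 1)) n m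
  refine ⟨N + 1, N.succ_pos, fun f hf => ?_⟩
  let emb : Fin (N + 1) ↪ ℕ := Fin.valEmbedding
  have hlt : ∀ T, ⌊f T / ε⌋₊ < ⌊1 / ε⌋₊ + 1 := fun T =>
    Nat.lt_succ_of_le (Nat.floor_le_floor (by gcongr; exact (hf T).2))
  obtain ⟨S, hSA, hS, d, hd⟩ := hN (Finset.univ.map emb) (by simp) fun T =>
    ⟨⌊f (T.preimage emb emb.injective.injOn) / ε⌋₊, hlt _⟩
  obtain ⟨R, -, rfl⟩ := Finset.subset_map_iff.mp hSA
  refine ⟨R, by rwa [Finset.card_map] at hS, fun j => (d j : ℕ) * ε, fun T hT _ hTn => ?_⟩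
  have h := congrArg Fin.val (hd (T.map emb) (Finset.map_subset_map.mpr hT)
    (by rwa [Finset.card_map]))
  simp only [Finset.preimage_map, Finset.card_map] at h
  beta_reduce
  rw [← h]
  constructor
  · exact (le_div_iff₀ hε).mp (Nat.floor_le (div_nonneg (hf T).1 hε.le))
  · have := (div_lt_iff₀ hε).mp (Nat.lt_floor_add_one (f T / ε))
    linarith
end

section
/- For every ε > 0 there exists a positive integer N such that for every function f : Finset (Fin N) → ℝ with 0 ≤ f T ≤ 1 for all T, there exist a vector x : Fin N → ℝ with x j ≥ 0 and ∑_j x j ≤ 1, and an index i ∈ Fin N with x i > 0, such that sel_f(x, i) < 1/e + ε, where sel_f(x, i) = ∑_{A ⊆ {j : j < i}} ( ∏_{j ∈ A} x j · ∏_{j < i, j ∉ A} (1 - x j) ) · ( ∏_{j ∈ A} (1 - f({k ∈ A : k ≤ j})) ) · f(A ∪ {i}). -/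
open Filter Topology Finset in
/-- There is a linear functional on real sequences that extends the limit along a
nonprincipal ultrafilter. -/
theorem exists_linearMap_hyperfilter_limit :
    ∃ L : (ℕ → ℝ) →ₗ[ℝ] ℝ, ∀ φ a, Tendsto φ (hyperfilter ℕ : Filter ℕ) (𝓝 a) → L φ = a := by
  let W : Submodule ℝ (ℕ → ℝ) :=
    { carrier := {φ | ∃ a, Tendsto φ (hyperfilter ℕ : Filter ℕ) (𝓝 a)}
      add_mem' := by
        rintro φ ψ ⟨a, ha⟩ ⟨b, hb⟩
        exact ⟨a + b, ha.add hb⟩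
      zero_mem' := ⟨0, tendsto_const_nhds⟩
      smul_mem' := by
        rintro c φ ⟨a, ha⟩
        exact ⟨c • a, ha.const_smul c⟩ }
  let ℓ : W →ₗ[ℝ] ℝ :=
    { toFun := fun φ => φ.2.choose
      map_add' := fun φ ψ => tendsto_nhds_unique (φ + ψ).2.choose_spec
        (φ.2.choose_spec.add ψ.2.choose_spec)
      map_smul' := fun c φ => tendsto_nhds_unique (c • φ).2.choose_spec
        (φ.2.choose_spec.const_smul c) }
  obtain ⟨L, hL⟩ := LinearMap.exists_extend ℓ
  refine ⟨L, fun φ a h => ?_⟩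
  have hφ : L φ = ℓ ⟨φ, a, h⟩ := by rw [← hL]; rfl
  rw [hφ]
  have hex : ∃ a, Tendsto φ (hyperfilter ℕ : Filter ℕ) (𝓝 a) := ⟨a, h⟩
  exact tendsto_nhds_unique hex.choose_spec h

open Filter Topology Finset in
theorem exists_tendsto_hyperfilter_of_abs_le {g : ℕ → ℝ} {C : ℝ} (hg : ∀ t, |g t| ≤ C) :
    ∃ a, Tendsto g (hyperfilter ℕ : Filter ℕ) (𝓝 a) := by
  obtain ⟨a, -, ha⟩ := (isCompact_Icc (a := -C) (b := C)).ultrafilter_le_nhds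
    ((hyperfilter ℕ).map g) (by
      rw [le_principal_iff]
      exact Filter.mem_map.mpr (Filter.univ_mem' fun t => abs_le.mp (hg t)))
  exact ⟨a, ha⟩

open Filter Topology Finset in
theorem le_limit_functional {L : (ℕ → ℝ) →ₗ[ℝ] ℝ}
    (hL : ∀ φ a, Tendsto φ (hyperfilter ℕ : Filter ℕ) (𝓝 a) → L φ = a)
    {g : ℕ → ℝ} {C r : ℝ} (hg : ∀ t, |g t| ≤ C) (hr : ∀ᶠ t in atTop, r ≤ g t) : r ≤ L g := by
  obtain ⟨a, ha⟩ := exists_tendsto_hyperfilter_of_abs_le hg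
  rw [hL g a ha]
  exact ge_of_tendsto ha (hr.filter_mono Nat.hyperfilter_le_atTop)

open Filter Topology Finset in
theorem abs_limit_functional_le {L : (ℕ → ℝ) →ₗ[ℝ] ℝ}
    (hL : ∀ φ a, Tendsto φ (hyperfilter ℕ : Filter ℕ) (𝓝 a) → L φ = a)
    {g : ℕ → ℝ} {C : ℝ} (hg : ∀ t, |g t| ≤ C) : |L g| ≤ C := by
  obtain ⟨a, ha⟩ := exists_tendsto_hyperfilter_of_abs_le hg
  rw [hL g a ha]
  exact le_of_tendsto ha.abs (Eventually.of_forall hg)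

/-- Averaging a set function over the next element with respect to the functional `L`. -/
def insertMean (L : (ℕ → ℝ) →ₗ[ℝ] ℝ) : Module.End ℝ (Finset ℕ → ℝ) where
  toFun φ T := L (fun t => φ (insert t T))
  map_add' φ ψ := by
    ext T
    exact L.map_add (fun t => φ (insert t T)) (fun t => ψ (insert t T))
  map_smul' c φ := by
    ext T
    exact L.map_smul c (fun t => φ (insert t T))

theorem insertMean_apply (L : (ℕ → ℝ) →ₗ[ℝ] ℝ) (φ : Finset ℕ → ℝ) (T : Finset ℕ) :
    insertMean L φ T = L (fun t => φ (insert t T)) := rfl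

open Filter Topology Finset in
/-- A lower bound on all averages over binomial random subsets of `m`-element sets passes to
the iterated limit. -/
theorem le_pow_insertMean {L : (ℕ → ℝ) →ₗ[ℝ] ℝ}
    (hL : ∀ φ a, Tendsto φ (hyperfilter ℕ : Filter ℕ) (𝓝 a) → L φ = a) (q r : ℝ) (m : ℕ) :
    ∀ (φ : Finset ℕ → ℝ) (C : ℝ), (∀ T, |φ T| ≤ C) →
      (∀ S : Finset ℕ, #S = m →
        r ≤ ∑ A ∈ S.powerset, q ^ #A * (1 - q) ^ (m - #A) * φ A) →
      r ≤ (((1 - q) • (1 : Module.End ℝ (Finset ℕ → ℝ)) + q • insertMean L) ^ m) φ ∅ := by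
  induction m with
  | zero =>
    intro φ C _ h
    simpa using h ∅ rfl
  | succ m ih =>
    intro φ C hC h
    rw [pow_succ]
    refine ih _ (|1 - q| * C + |q| * C) (fun T => ?_) (fun S hS => ?_)
    · simp only [LinearMap.add_apply, LinearMap.smul_apply, Module.End.one_apply, Pi.add_apply,
        Pi.smul_apply, smul_eq_mul, insertMean_apply]
      refine (abs_add_le _ _).trans ?_
      rw [abs_mul, abs_mul]
      have := abs_limit_functional_le hL (g := fun t => φ (insert t T)) (fun t => hC _)
      have := hC T
      gcongr
    · have hconst : ∀ a : ℝ, L (fun _ => a) = a := fun a => hL _ _ tendsto_const_nhds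
      have key : ∑ A ∈ S.powerset, q ^ #A * (1 - q) ^ (m - #A) *
            (((1 - q) • (1 : Module.End ℝ (Finset ℕ → ℝ)) + q • insertMean L) φ A) =
          L (∑ A ∈ S.powerset, (q ^ #A * (1 - q) ^ (m - #A)) •
            ((fun _ => (1 - q) * φ A) + q • fun t => φ (insert t A))) := by
        simp only [map_sum, map_smul, map_add, hconst]
        rfl
      rw [key]
      refine le_limit_functional hL (C := ∑ A ∈ S.powerset, |q ^ #A * (1 - q) ^ (m - #A)| *
        (|1 - q| * C + |q| * C)) (fun t => ?_) ?_
      · rw [Finset.sum_apply]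
        refine (Finset.abs_sum_le_sum_abs _ _).trans (Finset.sum_le_sum fun A _ => ?_)
        simp only [Pi.smul_apply, Pi.add_apply, smul_eq_mul]
        rw [abs_mul]
        refine mul_le_mul_of_nonneg_left ((abs_add_le _ _).trans ?_) (abs_nonneg _)
        rw [abs_mul, abs_mul]
        have := hC A
        have := hC (insert t A)
        gcongr
      · filter_upwards [eventually_gt_atTop (S.sup id)] with t ht
        have htS : t ∉ S := fun hmem => absurd (Finset.le_sup (f := id) hmem) (not_le.mpr ht)
        have h1 := h (insert t S) (by rw [card_insert_of_notMem htS, hS])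
        rw [Finset.sum_powerset_insert htS, ← Finset.sum_add_distrib] at h1
        refine h1.trans_eq ?_
        rw [Finset.sum_apply]
        refine Finset.sum_congr rfl fun A hA => ?_
        rw [mem_powerset] at hA
        have hcard := card_le_card hA
        rw [card_insert_of_notMem (fun hmem => htS (hA hmem)),
          show m + 1 - #A = (m - #A) + 1 by omega,
          show m + 1 - (#A + 1) = m - #A by omega]
        simp only [Pi.smul_apply, Pi.add_apply, smul_eq_mul]
        ring

/-- The probability that the scheme `f` accepts nothing when the active set is `A`. -/
def survival {α : Type*} [LinearOrder α] (f : Finset α → ℝ) (A : Finset α) : ℝ :=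
  ∏ j ∈ A, (1 - f (A.filter (fun k => k ≤ j)))

theorem survival_insert {α : Type*} [LinearOrder α] (f : Finset α → ℝ) {A : Finset α} {i : α}
    (hi : ∀ j ∈ A, j < i) :
    survival f (insert i A) = survival f A * (1 - f (insert i A)) := by
  have hiA : i ∉ A := fun h => lt_irrefl _ (hi i h)
  rw [survival, Finset.prod_insert hiA, mul_comm, survival]
  congr 1
  · refine Finset.prod_congr rfl fun j hj => ?_
    rw [Finset.filter_insert, if_neg (not_le.mpr (hi j hj))]
  · congr 2
    refine Finset.filter_true_of_mem fun j hj => ?_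
    rcases Finset.mem_insert.mp hj with rfl | hj
    · exact le_rfl
    · exact (hi j hj).le

theorem abs_survival_le_one {α : Type*} [LinearOrder α] {f : Finset α → ℝ}
    (hf : ∀ T, 0 ≤ f T ∧ f T ≤ 1) (A : Finset α) : |survival f A| ≤ 1 := by
  rw [survival, Finset.abs_prod]
  refine Finset.prod_le_one (fun _ _ => abs_nonneg _) fun j _ => ?_
  have := hf (A.filter (fun k => k ≤ j))
  rw [abs_le]
  constructor <;> linarith

open Finset in
/-- When each element of `S ∪ {i}` is active with probability `q` and no other element is,
the selection probability of the last element `i` is an average of survival differences. -/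
theorem selection_eq_sum_survival {N : ℕ} (f : Finset (Fin N) → ℝ) (q : ℝ)
    (S : Finset (Fin N)) (i : Fin N) (hi : ∀ j ∈ S, j < i) (x : Fin N → ℝ)
    (hx : ∀ j, x j = if j ∈ insert i S then q else 0) :
    ∑ A ∈ (Iio i).powerset,
        (∏ j ∈ A, x j) * (∏ j ∈ Iio i \ A, (1 - x j)) *
          (∏ j ∈ A, (1 - f (A.filter (fun k => k ≤ j)))) * f (insert i A) =
      ∑ A ∈ S.powerset, q ^ #A * (1 - q) ^ (#S - #A) *
        (survival f A - survival f (insert i A)) := by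
  have hSi : S ⊆ Iio i := fun j hj => mem_Iio.mpr (hi j hj)
  symm
  refine Finset.sum_subset_zero_on_sdiff (powerset_mono.mpr hSi) (fun A hA => ?_) (fun A hA => ?_)
  · rw [mem_sdiff, mem_powerset, mem_powerset] at hA
    obtain ⟨j, hjA, hjS⟩ := not_subset.mp hA.2
    have hj : x j = 0 := by
      rw [hx, if_neg]
      rw [mem_insert, not_or]
      exact ⟨(mem_Iio.mp (hA.1 hjA)).ne, hjS⟩
    rw [Finset.prod_eq_zero hjA hj]
    ring
  · rw [mem_powerset] at hA
    have h1 : ∏ j ∈ A, x j = q ^ #A :=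
      Finset.prod_eq_pow_card fun j hj => by rw [hx, if_pos (mem_insert_of_mem (hA hj))]
    have h2 : ∏ j ∈ Iio i \ A, (1 - x j) = (1 - q) ^ (#S - #A) := by
      rw [← card_sdiff_of_subset hA, ← Finset.prod_const]
      symm
      refine Finset.prod_subset_one_on_sdiff (sdiff_subset_sdiff hSi le_rfl)
        (fun j hj => ?_) (fun j hj => ?_)
      · simp only [mem_sdiff, mem_Iio, not_and, not_not] at hj
        rw [hx, if_neg, sub_zero]
        rw [mem_insert, not_or]
        exact ⟨hj.1.1.ne, fun h => hj.1.2 (hj.2 h)⟩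
      · rw [hx, if_pos (mem_insert_of_mem (mem_sdiff.mp hj).1)]
    rw [h1, h2, survival_insert f (fun j hj => hi j (hA hj)), survival]
    ring

/-- The elements of `Fin N` whose value lies in a finite set of natural numbers. -/
def toFin (N : ℕ) (A : Finset ℕ) : Finset (Fin N) :=
  Finset.univ.filter fun j => (j : ℕ) ∈ A

theorem mem_toFin {N : ℕ} {A : Finset ℕ} {j : Fin N} : j ∈ toFin N A ↔ (j : ℕ) ∈ A := by
  simp [toFin]

theorem map_toFin {N : ℕ} {A : Finset ℕ} (hA : ∀ j ∈ A, j < N) :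
    (toFin N A).map Fin.valEmbedding = A := by
  ext j
  simp only [Finset.mem_map, mem_toFin, Fin.valEmbedding_apply]
  exact ⟨fun ⟨k, hk, h⟩ => h ▸ hk, fun hj => ⟨⟨j, hA j hj⟩, hj, rfl⟩⟩

theorem card_toFin {N : ℕ} {A : Finset ℕ} (hA : ∀ j ∈ A, j < N) :
    (toFin N A).card = A.card := by
  rw [← Finset.card_map Fin.valEmbedding, map_toFin hA]

theorem toFin_insert {N : ℕ} (A : Finset ℕ) (i : Fin N) :
    toFin N (insert (i : ℕ) A) = insert i (toFin N A) := by
  ext j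
  simp [mem_toFin, Fin.val_inj]

open Finset in
theorem sum_powerset_toFin {N : ℕ} (S : Finset ℕ) (hS : ∀ j ∈ S, j < N)
    (F : Finset (Fin N) → ℝ) :
    ∑ A ∈ (toFin N S).powerset, F A = ∑ A ∈ S.powerset, F (toFin N A) := by
  symm
  refine Finset.sum_nbij' (toFin N) (fun A => A.map Fin.valEmbedding) ?_ ?_ ?_ ?_ ?_
  · intro A hA
    rw [mem_powerset] at hA ⊢
    exact fun j hj => mem_toFin.mpr (hA (mem_toFin.mp hj))
  · intro A hA
    rw [mem_powerset] at hA ⊢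
    intro j hj
    obtain ⟨k, hk, rfl⟩ := mem_map.mp hj
    exact mem_toFin.mp (hA hk)
  · intro A hA
    rw [mem_powerset] at hA
    exact map_toFin fun j hj => hS j (hA hj)
  · intro A _
    ext j
    simp [mem_toFin, Fin.val_inj]
  · intro A _
    rfl

theorem choose_mul_pow_le (m k : ℕ) (hk : k ≤ m) :
    (m.choose k : ℝ) * ((1 / (m + 1 : ℝ)) ^ k * (1 - 1 / (m + 1 : ℝ)) ^ (m - k)) ≤
      (1 - 1 / (m + 1 : ℝ)) ^ m := by
  have h : (1 - 1 / (m + 1 : ℝ)) = m * (1 / (m + 1 : ℝ)) := by field_simp; ring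
  have hchoose : (m.choose k : ℝ) ≤ (m : ℝ) ^ k := by exact_mod_cast Nat.choose_le_pow m k
  have hp : (0 : ℝ) ≤ 1 / (m + 1 : ℝ) := by positivity
  rw [h]
  calc (m.choose k : ℝ) * ((1 / (m + 1 : ℝ)) ^ k * (m * (1 / (m + 1 : ℝ))) ^ (m - k))
      ≤ (m : ℝ) ^ k * ((1 / (m + 1 : ℝ)) ^ k * (m * (1 / (m + 1 : ℝ))) ^ (m - k)) := by gcongr
    _ = (m * (1 / (m + 1 : ℝ))) ^ (k + (m - k)) := by rw [pow_add, mul_pow]; ring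
    _ = _ := by rw [Nat.add_sub_cancel' hk]

open Filter Topology in
theorem tendsto_one_sub_one_div_pow :
    Tendsto (fun m : ℕ => (1 - 1 / (m + 1 : ℝ)) ^ m) atTop (𝓝 (1 / Real.exp 1)) := by
  have h := (Real.tendsto_one_add_div_pow_exp 1).inv₀ (Real.exp_pos 1).ne'
  rw [one_div]
  refine h.congr' ?_
  filter_upwards [eventually_gt_atTop 0] with m hm
  have hm' : (0 : ℝ) < m := by exact_mod_cast hm
  rw [← inv_pow]
  congr 1
  field_simp
  ring

open Filter Topology Finset in
theorem pow_insertMean_nonneg {L : (ℕ → ℝ) →ₗ[ℝ] ℝ}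
    (hL : ∀ φ a, Tendsto φ (hyperfilter ℕ : Filter ℕ) (𝓝 a) → L φ = a) {C : ℝ} (k : ℕ) :
    ∀ φ : Finset ℕ → ℝ, (∀ T, 0 ≤ φ T) → (∀ T, |φ T| ≤ C) → 0 ≤ (insertMean L ^ k) φ ∅ := by
  induction k with
  | zero => exact fun φ h _ => h ∅
  | succ k ih =>
    intro φ h hC
    rw [pow_succ]
    exact ih _ (fun T => le_limit_functional hL (fun t => hC _) (Eventually.of_forall fun t => h _))
      (fun T => abs_limit_functional_le hL fun t => hC _)

open Filter Topology Finset in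
/-- The binomial mean of the decrements of a `[0, 1]`-valued set function is at most the
largest binomial weight. -/
theorem binomial_mean_decrement_le {L : (ℕ → ℝ) →ₗ[ℝ] ℝ}
    (hL : ∀ φ a, Tendsto φ (hyperfilter ℕ : Filter ℕ) (𝓝 a) → L φ = a)
    (Q : Finset ℕ → ℝ) (hQ0 : ∀ T, 0 ≤ Q T) (hQ1 : ∀ T, Q T ≤ 1)
    (hanti : ∀ T, insertMean L Q T ≤ Q T) (m : ℕ) :
    (((1 - 1 / (m + 1 : ℝ)) • (1 : Module.End ℝ (Finset ℕ → ℝ)) +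
      (1 / (m + 1 : ℝ)) • insertMean L) ^ m) (Q - insertMean L Q) ∅ ≤
      (1 - 1 / (m + 1 : ℝ)) ^ m := by
  have hQ : ∀ T, |Q T| ≤ 1 := fun T => abs_le.mpr ⟨by linarith [hQ0 T], hQ1 T⟩
  have hDQ : ∀ T, |insertMean L Q T| ≤ 1 := fun T => abs_limit_functional_le hL fun t => hQ _
  have hdec : ∀ k, 0 ≤ (insertMean L ^ k) (Q - insertMean L Q) ∅ := fun k =>
    pow_insertMean_nonneg hL (C := 1 + 1) k _ (fun T => sub_nonneg.mpr (hanti T)) fun T =>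
      (abs_sub _ _).trans (add_le_add (hQ T) (hDQ T))
  have htel : ∑ k ∈ range (m + 1), (insertMean L ^ k) (Q - insertMean L Q) ∅ ≤ 1 := by
    have h : ∀ k, (insertMean L ^ k) (Q - insertMean L Q) ∅ =
        (insertMean L ^ k) Q ∅ - (insertMean L ^ (k + 1)) Q ∅ := fun k => by
      rw [map_sub, pow_succ]
      rfl
    simp only [h]
    rw [Finset.sum_range_sub']
    have h0 : (insertMean L ^ 0) Q ∅ = Q ∅ := rfl
    linarith [hQ1 ∅, pow_insertMean_nonneg hL (m + 1) Q hQ0 hQ]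
  have hw : 0 ≤ (1 - 1 / (m + 1 : ℝ)) ^ m :=
    pow_nonneg (by rw [sub_nonneg, div_le_one (by positivity)]; linarith [m.cast_nonneg (α := ℝ)]) m
  have hcomm : Commute ((1 / (m + 1 : ℝ)) • insertMean L)
      ((1 - 1 / (m + 1 : ℝ)) • (1 : Module.End ℝ (Finset ℕ → ℝ))) :=
    ((Commute.one_right _).smul_right _)
  rw [add_comm, hcomm.add_pow, LinearMap.sum_apply, Finset.sum_apply]
  calc _ = ∑ k ∈ range (m + 1), (m.choose k : ℝ) *
          ((1 / (m + 1 : ℝ)) ^ k * (1 - 1 / (m + 1 : ℝ)) ^ (m - k)) *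
          (insertMean L ^ k) (Q - insertMean L Q) ∅ := by
        refine Finset.sum_congr rfl fun k _ => ?_
        rw [smul_pow, smul_pow, one_pow, ← nsmul_eq_mul', smul_mul_smul_comm, mul_one,
          ← Nat.cast_smul_eq_nsmul ℝ, smul_smul]
        rfl
    _ ≤ ∑ k ∈ range (m + 1), (1 - 1 / (m + 1 : ℝ)) ^ m *
          (insertMean L ^ k) (Q - insertMean L Q) ∅ := by
        refine Finset.sum_le_sum fun k hk => mul_le_mul_of_nonneg_right ?_ (hdec k)
        exact choose_mul_pow_le m k (Nat.lt_succ_iff.mp (mem_range.mp hk))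
    _ ≤ (1 - 1 / (m + 1 : ℝ)) ^ m := by
        rw [← Finset.mul_sum]
        exact mul_le_of_le_one_right hw htel

open Filter Topology Finset in
/-- No oblivious single-item OCRS is `(1/e + ε)`-selectable: for every `ε > 0` there is a
ground-set size `N` such that for every scheme `f : Finset (Fin N) → [0,1]` there are a
feasible activity vector `x` and an index `i` with `x i > 0` whose conditional selection
probability `sel_f(x, i)` is less than `1/e + ε`. -/
theorem stmt7 (ε : ℝ) (hε : 0 < ε) :
    ∃ N : ℕ, 0 < N ∧ ∀ f : Finset (Fin N) → ℝ, (∀ T, 0 ≤ f T ∧ f T ≤ 1) →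
      ∃ x : Fin N → ℝ, (∀ j, 0 ≤ x j) ∧ (∑ j, x j ≤ 1) ∧
        ∃ i : Fin N, 0 < x i ∧
          ∑ A ∈ (Finset.Iio i).powerset,
              (∏ j ∈ A, x j) * (∏ j ∈ Finset.Iio i \ A, (1 - x j)) *
                (∏ j ∈ A, (1 - f (A.filter (fun k => k ≤ j)))) * f (insert i A) <
            1 / Real.exp 1 + ε := by
  by_contra! hbad
  choose f hf hsel using fun N : ℕ => hbad (N + 1) N.succ_pos
  obtain ⟨L, hL⟩ := exists_linearMap_hyperfilter_limit
  obtain ⟨m, hm⟩ := (tendsto_one_sub_one_div_pow.eventually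
    (gt_mem_nhds (lt_add_of_pos_right (1 / Real.exp 1) hε))).exists
  refine hm.not_ge ?_
  let s : Finset ℕ → ℕ → ℝ := fun A N => survival (f N) (toFin (N + 1) A)
  have hs : ∀ A N, |s A N| ≤ 1 := fun A N => abs_survival_le_one (hf N) _
  have hs0 : ∀ A N, 0 ≤ s A N := fun A N =>
    Finset.prod_nonneg fun j _ => sub_nonneg.mpr (hf N _).2
  let Q : Finset ℕ → ℝ := fun A => L (s A)
  have hQ : ∀ A, |Q A| ≤ 1 := fun A => abs_limit_functional_le hL (hs A)
  have hconst : ∀ a : ℝ, L (fun _ => a) = a := fun a => hL _ _ tendsto_const_nhds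
  have hmean : ∀ A, (Q - insertMean L Q) A = L (fun i => Q A - Q (insert i A)) := fun A => by
    have : (fun i => Q A - Q (insert i A)) = (fun _ => Q A) - fun i => Q (insert i A) := rfl
    rw [this, map_sub, hconst]
    rfl
  have hlt : ∀ (A : Finset ℕ) i, A.sup id < i → ∀ j ∈ A, j < i := fun A i hi j hj =>
    (Finset.le_sup (f := id) hj).trans_lt hi
  have hQ2 : ∀ A B, |Q A - Q B| ≤ 2 := fun A B =>
    (abs_sub _ _).trans (by linarith [hQ A, hQ B])
  have hs2 : ∀ A B N, |(s A - s B) N| ≤ 2 := fun A B N =>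
    (abs_sub _ _).trans (by linarith [hs A N, hs B N])
  have hanti : ∀ T, insertMean L Q T ≤ Q T := fun T => by
    rw [← sub_nonneg]
    change 0 ≤ (Q - insertMean L Q) T
    rw [hmean]
    refine le_limit_functional hL (fun i => hQ2 _ _) ?_
    filter_upwards [eventually_gt_atTop (T.sup id)] with i hi
    change 0 ≤ L (s T) - L (s (insert i T))
    rw [← map_sub]
    refine le_limit_functional hL (hs2 _ _) ?_
    filter_upwards [eventually_ge_atTop i] with N hN
    have hins := toFin_insert T (⟨i, Nat.lt_succ_of_le hN⟩ : Fin (N + 1))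
    have hmul : s (insert i T) N = s T N * (1 - f N (toFin (N + 1) (insert i T))) := by
      simp only [s, hins]
      exact survival_insert _ fun j hj => hlt T i hi j (mem_toFin.mp hj)
    rw [Pi.sub_apply, hmul]
    have := mul_nonneg (hs0 T N) (hf N (toFin (N + 1) (insert i T))).1
    linarith
  refine le_trans ?_ (binomial_mean_decrement_le hL Q
    (fun T => le_limit_functional hL (hs T) (Eventually.of_forall (hs0 T)))
    (fun T => (abs_le.mp (hQ T)).2) hanti m)
  have hq : (0 : ℝ) < 1 / (m + 1 : ℝ) := by positivity
  generalize hqdef : 1 / (m + 1 : ℝ) = q at hq ⊢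
  have hqm : ((m + 1 : ℕ) : ℝ) * q ≤ 1 := by
    rw [← hqdef]
    push_cast
    exact (mul_one_div_cancel (by positivity)).le
  refine le_pow_insertMean hL _ _ m _ 2 (fun T => ?_) fun S hS => ?_
  · rw [hmean]
    exact abs_limit_functional_le hL fun i => hQ2 _ _
  have hswap : ∑ A ∈ S.powerset, q ^ #A * (1 - q) ^ (m - #A) * (Q - insertMean L Q) A =
      L (∑ A ∈ S.powerset, (q ^ #A * (1 - q) ^ (m - #A)) • fun i => Q A - Q (insert i A)) := by
    simp only [map_sum, map_smul, hmean, smul_eq_mul]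
  have hbound : ∀ (g : Finset ℕ → ℕ → ℝ), (∀ A t, |g A t| ≤ 2) → ∀ t,
      |(∑ A ∈ S.powerset, (q ^ #A * (1 - q) ^ (m - #A)) • g A) t| ≤
        ∑ A ∈ S.powerset, |q ^ #A * (1 - q) ^ (m - #A)| * 2 := fun g hg t => by
    rw [Finset.sum_apply]
    refine (Finset.abs_sum_le_sum_abs _ _).trans (Finset.sum_le_sum fun A _ => ?_)
    rw [Pi.smul_apply, smul_eq_mul, abs_mul]
    exact mul_le_mul_of_nonneg_left (hg A t) (abs_nonneg _)
  rw [hswap]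
  refine le_limit_functional hL (hbound _ fun A i => hQ2 _ _) ?_
  filter_upwards [eventually_gt_atTop (S.sup id)] with i hi
  have hswap' : (∑ A ∈ S.powerset, (q ^ #A * (1 - q) ^ (m - #A)) •
        fun i => Q A - Q (insert i A)) i =
      L (∑ A ∈ S.powerset, (q ^ #A * (1 - q) ^ (m - #A)) • (s A - s (insert i A))) := by
    simp only [map_sum, map_smul, map_sub, Finset.sum_apply, Pi.smul_apply]
    rfl
  rw [hswap']
  refine le_limit_functional hL (hbound _ fun A N => hs2 _ _ N) ?_
  filter_upwards [eventually_ge_atTop i] with N hN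
  obtain ⟨i, rfl⟩ : ∃ i' : Fin (N + 1), (i' : ℕ) = i := ⟨⟨i, Nat.lt_succ_of_le hN⟩, rfl⟩
  have hSN : ∀ j ∈ S, j < N + 1 := fun j hj => (hlt S _ hi j hj).trans i.isLt
  have hiS : ∀ j ∈ toFin (N + 1) S, j < i := fun j hj => hlt S _ hi j (mem_toFin.mp hj)
  have hcard : #(toFin (N + 1) S) = m := (card_toFin hSN).trans hS
  let x : Fin (N + 1) → ℝ := fun j => if j ∈ insert i (toFin (N + 1) S) then q else 0
  have hx := hsel N x (fun j => by dsimp only [x]; split_ifs <;> linarith) (by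
      simp only [x]
      rw [← Finset.sum_filter, Finset.filter_univ_mem, Finset.sum_const,
        card_insert_of_notMem (fun h => lt_irrefl _ (hiS i h)), hcard, nsmul_eq_mul]
      exact hqm) i (by simpa [x] using hq)
  rw [selection_eq_sum_survival (f N) q (toFin (N + 1) S) i hiS x (fun _ => rfl),
    sum_powerset_toFin S hSN] at hx
  refine hx.trans_eq ?_
  rw [Finset.sum_apply]
  refine Finset.sum_congr rfl fun A hA => ?_
  rw [card_toFin fun j hj => hSN j (mem_powerset.mp hA hj), hcard, ← toFin_insert]
  rfl
end

section
/- For every c ∈ (0, 1] there exist positive integers N and M with the following property. Let E = Fin N × Fin M be the edge set of the complete bipartite graph K_{N,M}, and for i ∈ Fin N define x^i : E → ℝ by x^i(a, b) = 1 if a = i and x^i(a, b) = 1/M otherwise. Then there is no function π from realizations ω : E → Bool to probability mass functions on Finset E such that: (feasibility) for every ω, every T in the support of π(ω) satisfies T ⊆ {e : ω e = true} and the simple graph on Fin N ⊕ Fin M with edge set {{inl a, inr b} : (a,b) ∈ T} is acyclic; and (c-balancedness for every x^i) for every i ∈ Fin N and every e ∈ E, the probability that e ∈ T, when ω is drawn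 from the product of Bernoulli(x^i(e')) distributions over e' ∈ E and then T is drawn from π(ω), is at least c · x^i(e). -/
open Finset

/-- An acyclic graph on a finite vertex type has at most as many edges as vertices. -/
theorem SimpleGraph.IsAcyclic.card_edgeFinset_le {V : Type*} [Fintype V] {G : SimpleGraph V}
    [Fintype G.edgeSet] (hG : G.IsAcyclic) : #G.edgeFinset ≤ Fintype.card V := by
  classical
  rcases isEmpty_or_nonempty V with hV | hV
  · have : IsEmpty (Sym2 V) := by
      refine ⟨fun e => ?_⟩
      induction e with
      | _ x y => exact hV.elim x
    simp [Finset.eq_empty_of_isEmpty]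
  · obtain ⟨T, hGT, -, hT⟩ :=
      (SimpleGraph.connected_top (V := V)).exists_isTree_le_of_le_of_isAcyclic le_top hG
    have hcard := hT.card_edgeFinset
    have hle : #G.edgeFinset ≤ #T.edgeFinset :=
      Finset.card_le_card (SimpleGraph.edgeFinset_subset_edgeFinset.2 hGT)
    omega

/-- The bipartite graph on `α ⊕ β` whose edges are the pairs in `F`. -/
abbrev bipartiteGraphOf {α β : Type*} (F : Finset (α × β)) : SimpleGraph (α ⊕ β) :=
  SimpleGraph.fromRel fun p q => ∃ a b, (a, b) ∈ F ∧ p = Sum.inl a ∧ q = Sum.inr b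

theorem bipartiteGraphOf_adj_inl_inr {α β : Type*} {F : Finset (α × β)} {a : α} {b : β} :
    (bipartiteGraphOf F).Adj (Sum.inl a) (Sum.inr b) ↔ (a, b) ∈ F := by
  simp [SimpleGraph.fromRel_adj]

theorem card_le_of_isAcyclic_bipartiteGraphOf {α β : Type*} [Fintype α] [Fintype β]
    {F : Finset (α × β)} (hF : (bipartiteGraphOf F).IsAcyclic) :
    #F ≤ Fintype.card α + Fintype.card β := by
  classical
  rw [← Fintype.card_sum]
  refine le_trans ?_ hF.card_edgeFinset_le
  refine Finset.card_le_card_of_injOn (fun e => s(Sum.inl e.1, Sum.inr e.2)) ?_ ?_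
  · rintro ⟨a, b⟩ hab
    simpa only [SimpleGraph.coe_edgeFinset, SimpleGraph.mem_edgeSet,
      bipartiteGraphOf_adj_inl_inr, Finset.mem_coe] using hab
  · rintro ⟨a, b⟩ - ⟨a', b'⟩ - h
    simpa using h

/-- A bipartite forest has at most `#R + |β|` edges incident to a set `R` of left vertices. -/
theorem card_filter_fst_mem_le_of_isAcyclic {α β : Type*} [DecidableEq α] [Fintype β]
    {F : Finset (α × β)} (hF : (bipartiteGraphOf F).IsAcyclic) (R : Finset α) :
    #{e ∈ F | e.1 ∈ R} ≤ #R + Fintype.card β := by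
  classical
  let F' : Finset (R × β) := {e | (e.1.1, e.2) ∈ F}
  have hcard : #{e ∈ F | e.1 ∈ R} ≤ #F' := by
    refine Finset.card_le_card_of_surjOn (fun e : R × β => (e.1.1, e.2)) ?_
    rintro ⟨a, b⟩ hab
    simp only [coe_filter, Set.mem_ofPred_eq] at hab
    exact ⟨(⟨a, hab.2⟩, b), by simpa [F'] using hab.1, rfl⟩
  have hF' : (bipartiteGraphOf F').IsAcyclic := by
    refine hF.comap ⟨Sum.map Subtype.val id, ?_⟩
      (Sum.map_injective.2 ⟨Subtype.val_injective, Function.injective_id⟩)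
    rintro (x | x) (y | y) h
    · simp at h
    · simpa [F'] using h
    · simpa [F'] using h
    · simp at h
  have := card_le_of_isAcyclic_bipartiteGraphOf hF'
  rw [Fintype.card_coe] at this
  exact hcard.trans this

/-- A random bipartite forest contains on average at most `#R + |β|` edges incident to a set `R`
of left vertices. -/
theorem sum_marginals_le_of_isAcyclic {α β : Type*} [Fintype α] [DecidableEq α] [Fintype β]
    [DecidableEq β] {μ : Finset (α × β) → ℝ} (h0 : ∀ T, 0 ≤ μ T) (h1 : ∑ T, μ T = 1)
    (hμ : ∀ T, 0 < μ T → (bipartiteGraphOf T).IsAcyclic) (R : Finset α) :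
    ∑ a ∈ R, ∑ b, ∑ T, (if (a, b) ∈ T then μ T else 0) ≤ #R + Fintype.card β := by
  have hT (T : Finset (α × β)) :
      ∑ e ∈ R ×ˢ (univ : Finset β), (if e ∈ T then μ T else 0) = #{e ∈ T | e.1 ∈ R} * μ T := by
    rw [← Finset.sum_filter, Finset.sum_const, nsmul_eq_mul]
    congr 3
    ext e
    simp [and_comm]
  calc ∑ a ∈ R, ∑ b, ∑ T, (if (a, b) ∈ T then μ T else 0)
      = ∑ T, #{e ∈ T | e.1 ∈ R} * μ T := by
        rw [← Finset.sum_product' (f := fun a b => ∑ T, (if (a, b) ∈ T then μ T else 0)),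
          Finset.sum_comm]
        exact Finset.sum_congr rfl fun T _ => hT T
    _ ≤ ∑ T, (#R + Fintype.card β : ℝ) * μ T := by
        refine Finset.sum_le_sum fun T _ => ?_
        rcases (h0 T).eq_or_lt with h | h
        · simp [← h]
        · exact mul_le_mul_of_nonneg_right
            (mod_cast card_filter_fst_mem_le_of_isAcyclic (hμ T h) R) h.le
    _ = #R + Fintype.card β := by rw [← Finset.mul_sum, h1, mul_one]

/-- The probability of the realization `ω` when each `e` is independently active with probability
`p e`. -/
abbrev realizationProb {E : Type*} [Fintype E] (p : E → ℝ) (ω : E → Bool) : ℝ :=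
  ∏ e, if ω e = true then p e else 1 - p e

theorem sum_realizationProb {E : Type*} [Fintype E] [DecidableEq E] (p : E → ℝ) :
    ∑ ω, realizationProb p ω = 1 := by
  have := Finset.prod_univ_sum (fun _ : E => (univ : Finset Bool))
    (fun e b => if b = true then p e else 1 - p e)
  rw [Fintype.piFinset_univ] at this
  rw [← this]
  simp

/-- The rows all of whose edges are active. -/
def activeRows {α β : Type*} [Fintype α] [Fintype β] (ω : α × β → Bool) : Finset α :=
  {a | ∀ b, ω (a, b) = true}

/-- Forcing row `i` to be active amounts to conditioning on the event that it is. -/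
theorem realizationProb_row_mul {α β : Type*} [Fintype α] [DecidableEq α] [Fintype β]
    (p : ℝ) (i : α) (ω : α × β → Bool) :
    realizationProb (fun e => if e.1 = i then 1 else p) ω * p ^ Fintype.card β =
      if i ∈ activeRows ω then realizationProb (fun _ => p) ω else 0 := by
  have hrow : ∏ e : α × β, (if e.1 = i then p else 1) = p ^ Fintype.card β := by
    rw [Fintype.prod_prod_type, Finset.prod_eq_single i] <;> simp +contextual
  have hact : ∏ e : α × β, (if e.1 = i then (if ω e = true then (1 : ℝ) else 0) else 1) =
      if i ∈ activeRows ω then 1 else 0 := by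
    rw [Fintype.prod_prod_type, Finset.prod_eq_single i]
    · simp [activeRows, Fintype.prod_ite_zero]
    · simp +contextual
    · simp
  rw [← hrow, ← one_mul (realizationProb (fun _ => p) ω),
    ← zero_mul (realizationProb (fun _ => p) ω), ← ite_mul, ← hact,
    ← Finset.prod_mul_distrib, ← Finset.prod_mul_distrib]
  refine Finset.prod_congr rfl fun e _ => ?_
  by_cases he : e.1 = i <;> by_cases hω : ω e = true <;> simp [he, hω]

/-- If a random forest of active edges accepts every edge of an active row with probability at
least `c`, for each choice of the forced row, then the size of the row bounds the number of rows. -/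
theorem mul_card_mul_card_le_of_balanced {α β : Type*} [Fintype α] [DecidableEq α] [Fintype β]
    [DecidableEq β] {c p : ℝ} (hp0 : 0 ≤ p) (hp1 : p ≤ 1)
    {π : (α × β → Bool) → Finset (α × β) → ℝ}
    (h0 : ∀ ω T, 0 ≤ π ω T) (h1 : ∀ ω, ∑ T, π ω T = 1)
    (hπ : ∀ ω T, 0 < π ω T → (bipartiteGraphOf T).IsAcyclic)
    (hc : ∀ i b, c ≤ ∑ ω, realizationProb (fun e => if e.1 = i then 1 else p) ω *
      ∑ T, (if (i, b) ∈ T then π ω T else 0)) :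
    Fintype.card α * (Fintype.card β * c) * p ^ Fintype.card β ≤
      Fintype.card α * p ^ Fintype.card β + Fintype.card β := by
  have hQ (ω : α × β → Bool) : 0 ≤ realizationProb (fun _ : α × β => p) ω :=
    Finset.prod_nonneg fun e _ => by split_ifs <;> linarith
  have hexp : ∑ ω, realizationProb (fun _ : α × β => p) ω * #(activeRows ω) =
      Fintype.card α * p ^ Fintype.card β := by
    have (ω : α × β → Bool) : realizationProb (fun _ : α × β => p) ω * #(activeRows ω) =
        ∑ i, realizationProb (fun e => if e.1 = i then 1 else p) ω * p ^ Fintype.card β := by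
      simp_rw [realizationProb_row_mul]
      simp [mul_comm]
    simp_rw [this]
    rw [Finset.sum_comm]
    simp_rw [← Finset.sum_mul, sum_realizationProb]
    simp
  calc Fintype.card α * (Fintype.card β * c) * p ^ Fintype.card β
      = (∑ _i : α, ∑ _b : β, c) * p ^ Fintype.card β := by simp
    _ ≤ (∑ i, ∑ b, ∑ ω, realizationProb (fun e => if e.1 = i then 1 else p) ω *
          ∑ T, (if (i, b) ∈ T then π ω T else 0)) * p ^ Fintype.card β := by
        gcongr with i _ b _
        exact hc i b
    _ = ∑ ω, ∑ i, (realizationProb (fun e => if e.1 = i then 1 else p) ω * p ^ Fintype.card β) *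
          ∑ b, ∑ T, (if (i, b) ∈ T then π ω T else 0) := by
        conv_rhs => rw [Finset.sum_comm]
        rw [Finset.sum_mul]
        refine Finset.sum_congr rfl fun i _ => ?_
        rw [Finset.sum_comm, Finset.sum_mul]
        refine Finset.sum_congr rfl fun ω _ => ?_
        rw [← Finset.mul_sum]
        ring
    _ = ∑ ω, realizationProb (fun _ : α × β => p) ω *
          ∑ i ∈ activeRows ω, ∑ b, ∑ T, (if (i, b) ∈ T then π ω T else 0) := by
        refine Finset.sum_congr rfl fun ω _ => ?_
        simp_rw [realizationProb_row_mul, ite_mul, zero_mul]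
        rw [← Finset.sum_filter, Finset.filter_mem_eq_inter, Finset.univ_inter, Finset.mul_sum]
    _ ≤ ∑ ω, realizationProb (fun _ : α × β => p) ω * (#(activeRows ω) + Fintype.card β) := by
        refine Finset.sum_le_sum fun ω _ => mul_le_mul_of_nonneg_left ?_ (hQ ω)
        exact sum_marginals_le_of_isAcyclic (h0 ω) (h1 ω) (hπ ω) _
    _ = Fintype.card α * p ^ Fintype.card β + Fintype.card β := by
        simp_rw [mul_add]
        rw [Finset.sum_add_distrib, hexp, ← Finset.sum_mul, sum_realizationProb, one_mul]


/-- No oblivious `c`-balanced CRS exists for graphic matroids: for every `c ∈ (0, 1]`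
there are sizes `N, M` such that, on the complete bipartite graph `K_{N,M}` with edge set
`E = Fin N × Fin M` and the ex ante vectors `x^i` (equal to `1` on edges incident to the
left vertex `i` and `1/M` elsewhere), no scheme `π` mapping realizations `ω : E → Bool`
to probability mass functions on `Finset E` can simultaneously output, with probability 1,
a forest of active edges, and accept every edge with probability at least `c · x^i(e)`
under every `x^i`. -/
theorem stmt11 (c : ℝ) (hc0 : 0 < c) (hc1 : c ≤ 1) :
    ∃ N M : ℕ, 0 < N ∧ 0 < M ∧
      ¬ ∃ π : ((Fin N × Fin M) → Bool) → (Finset (Fin N × Fin M) → ℝ),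
        (∀ ω, (∀ T, 0 ≤ π ω T) ∧ ∑ T, π ω T = 1) ∧
        (∀ ω T, 0 < π ω T →
          (∀ e ∈ T, ω e = true) ∧
          (SimpleGraph.fromRel (fun p q =>
              ∃ (a : Fin N) (b : Fin M), (a, b) ∈ T ∧ p = Sum.inl a ∧ q = Sum.inr b) :
              SimpleGraph (Fin N ⊕ Fin M)).IsAcyclic) ∧
        (∀ i : Fin N, ∀ e : Fin N × Fin M,
          c * (if e.1 = i then 1 else 1 / (M : ℝ)) ≤
            ∑ ω : (Fin N × Fin M) → Bool,
              (∏ e' : Fin N × Fin M,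
                  (if ω e' = true then (if e'.1 = i then 1 else 1 / (M : ℝ))
                   else 1 - (if e'.1 = i then 1 else 1 / (M : ℝ)))) *
                ∑ T : Finset (Fin N × Fin M), (if e ∈ T then π ω T else 0)) := by
  obtain ⟨M, hM⟩ := exists_nat_gt (2 / c)
  have hM' : 2 < M * c := (div_lt_iff₀ hc0).1 hM
  have hMpos : (0 : ℝ) < M := lt_trans (by positivity) hM
  have hM1 : 1 ≤ M := by exact_mod_cast hMpos
  refine ⟨M ^ (M + 1), M, by positivity, by omega, ?_⟩
  rintro ⟨π, hprob, hfeas, hbal⟩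
  have key := mul_card_mul_card_le_of_balanced (c := c) (p := 1 / (M : ℝ)) (by positivity)
    ((div_le_one hMpos).2 (mod_cast hM1)) (fun ω => (hprob ω).1) (fun ω => (hprob ω).2)
    (fun ω T hT => (hfeas ω T hT).2) (fun i b => by simpa using hbal i (i, b))
  have hpow : (M : ℝ) ^ (M + 1) * (1 / M) ^ M = M := by
    rw [pow_succ, mul_right_comm, ← mul_pow, mul_one_div_cancel hMpos.ne', one_pow, one_mul]
  simp only [Fintype.card_fin, Nat.cast_pow] at key
  rw [mul_right_comm, hpow] at key
  nlinarith
end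

section
/- For every c ∈ (0, 1] and every natural number s there exist positive integers N and M with the following property. Let E = Fin N × Fin M and define x^i : E → ℝ by x^i(a, b) = 1 if a = i and 1/M otherwise. Then there is no function π from (s+1)-tuples of realizations (ω₀, …, ω_s), each ω_t : E → Bool, to probability mass functions on Finset E such that: (feasibility) for all inputs, every T in the support of π(ω₀,…,ω_s) satisfies T ⊆ {e : ω_s e = true} and the simple graph on Fin N ⊕ Fin M with edge set {{inl a, inr b} : (a,b) ∈ T} is acyclic; and (c-balancedness) for every i ∈ Fin N and every e ∈ E, the probability that e ∈ T, when ω₀, …, ω_s are drawn independently, each from the product of Bernoulli(x^i(e')) distributions over e' ∈ E, and then T is drawn from π(ω₀,…,ω_s), is at least c · x^i(e). -/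
/-- A forest on a finite nonempty vertex type has fewer edges than vertices. -/
theorem SimpleGraph.IsAcyclic.card_edgeFinset_lt {V : Type*} [Fintype V] [Nonempty V]
    {G : SimpleGraph V} [Fintype G.edgeSet] (hG : G.IsAcyclic) :
    G.edgeFinset.card < Fintype.card V := by
  classical
  obtain ⟨H, hGH, -, hH⟩ :=
    (SimpleGraph.connected_top (V := V)).exists_isTree_le_of_le_of_isAcyclic le_top hG
  have h := hH.card_edgeFinset
  have h2 : G.edgeFinset.card ≤ H.edgeFinset.card :=
    Finset.card_le_card (SimpleGraph.edgeFinset_mono hGH)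
  omega

/-- A forest in a complete bipartite graph has at most `#F + M` edges touching
a set `F` of left vertices. -/
theorem card_filter_fst_mem_le_of_isAcyclic_s12 {N M : ℕ} (hM : 0 < M) (T : Finset (Fin N × Fin M))
    (hT : (SimpleGraph.fromRel (fun p q =>
      ∃ (a : Fin N) (b : Fin M), (a, b) ∈ T ∧ p = Sum.inl a ∧ q = Sum.inr b) :
      SimpleGraph (Fin N ⊕ Fin M)).IsAcyclic) (F : Finset (Fin N)) :
    (T.filter (fun e => e.1 ∈ F)).card ≤ F.card + M := by
  classical
  have : Nonempty (Fin M) := ⟨⟨0, hM⟩⟩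
  let f : (F ⊕ Fin M) ↪ (Fin N ⊕ Fin M) :=
    ⟨Sum.map Subtype.val id, Sum.map_injective.2 ⟨Subtype.val_injective, Function.injective_id⟩⟩
  have h1 := (hT.of_comap f).card_edgeFinset_lt
  rw [Fintype.card_sum, Fintype.card_coe, Fintype.card_fin] at h1
  refine le_trans ?_ h1.le
  refine Finset.card_le_card_of_injOn
    (fun e => if h : e.1 ∈ F then s(Sum.inl ⟨e.1, h⟩, Sum.inr e.2) else s(Sum.inr e.2, Sum.inr e.2))
    ?_ ?_
  · rintro ⟨a, b⟩ he
    simp only [Finset.coe_filter, Set.mem_ofPred_eq] at he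
    simp [he.2, f, he.1]
  · rintro ⟨a, b⟩ he ⟨a', b'⟩ he' h
    simp only [Finset.coe_filter, Set.mem_ofPred_eq] at he he'
    simpa [he.2, he'.2] using h

/-- Product Bernoulli weights of tuples of realizations sum to one. -/
theorem sum_prod_bernoulli_eq_one {ι κ : Type*} [Fintype ι] [DecidableEq ι] [Fintype κ]
    [DecidableEq κ] (p : κ → ℝ) :
    ∑ ω : ι → κ → Bool, ∏ t, ∏ e, (if ω t e = true then p e else 1 - p e) = 1 := by
  rw [← Fintype.prod_sum (fun (_ : ι) (g : κ → Bool) =>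
    ∏ e, (if g e = true then p e else 1 - p e))]
  refine Finset.prod_eq_one fun t _ => ?_
  rw [← Fintype.prod_sum (fun (e : κ) (x : Bool) => if x = true then p e else 1 - p e)]
  exact Finset.prod_eq_one fun e _ => by simp

/-- Raising the activation probabilities in row `i` from `1 / M` to `1` conditions the
product Bernoulli distribution on row `i` being active in all realizations. -/
theorem prod_bernoulli_row_eq {ι : Type*} [Fintype ι] {N M : ℕ} (hM : 0 < M) (i : Fin N)
    (ω : ι → Fin N × Fin M → Bool) [Decidable (∀ t b, ω t (i, b) = true)] :
    (∏ t, ∏ e : Fin N × Fin M,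
      (if ω t e = true then (if e.1 = i then 1 else 1 / (M : ℝ))
        else 1 - (if e.1 = i then 1 else 1 / (M : ℝ)))) =
      (∏ t, ∏ e : Fin N × Fin M, (if ω t e = true then 1 / (M : ℝ) else 1 - 1 / (M : ℝ))) *
        (if ∀ t b, ω t (i, b) = true then ((M : ℝ) ^ M) ^ Fintype.card ι else 0) := by
  classical
  have hMne : (M : ℝ) ≠ 0 := by positivity
  have hrow : (∏ t, ∏ e : Fin N × Fin M,
      (if e.1 = i then (if ω t e = true then (M : ℝ) else 0) else 1)) =
      if ∀ t b, ω t (i, b) = true then ((M : ℝ) ^ M) ^ Fintype.card ι else 0 := by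
    simp_rw [Fintype.prod_prod_type]
    have h (t : ι) : (∏ a : Fin N, ∏ b : Fin M,
        (if a = i then (if ω t (a, b) = true then (M : ℝ) else 0) else 1)) =
        if ∀ b, ω t (i, b) = true then (M : ℝ) ^ M else 0 := by
      rw [Finset.prod_eq_single i (fun a _ ha => by simp [ha]) (by simp)]
      simp [Fintype.prod_ite_zero]
    simp_rw [h, Fintype.prod_ite_zero]
    simp
  rw [← hrow, ← Finset.prod_mul_distrib]
  refine Finset.prod_congr rfl fun t _ => ?_
  rw [← Finset.prod_mul_distrib]
  refine Finset.prod_congr rfl fun e _ => ?_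
  split_ifs <;> simp [hMne]


/-- Even with `s` additional independent samples of the random active set, no `c`-balanced
CRS exists for graphic matroids: for every `c ∈ (0, 1]` and every `s : ℕ` there are sizes
`N, M` such that no scheme `π` mapping `(s+1)`-tuples of realizations `(ω₀, …, ω_s)`
(the last one being the true realization, the others samples) to probability mass
functions on `Finset E`, `E = Fin N × Fin M`, can always output a forest of edges active
in `ω_s` while accepting every edge with probability at least `c · x^i(e)` when all the
`ω_t` are drawn independently from the product Bernoulli distribution given by `x^i`. -/
theorem stmt12 (c : ℝ) (hc0 : 0 < c) (hc1 : c ≤ 1) (s : ℕ) :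
    ∃ N M : ℕ, 0 < N ∧ 0 < M ∧
      ¬ ∃ π : (Fin (s + 1) → ((Fin N × Fin M) → Bool)) → (Finset (Fin N × Fin M) → ℝ),
        (∀ ω, (∀ T, 0 ≤ π ω T) ∧ ∑ T, π ω T = 1) ∧
        (∀ ω T, 0 < π ω T →
          (∀ e ∈ T, ω (Fin.last s) e = true) ∧
          (SimpleGraph.fromRel (fun p q =>
              ∃ (a : Fin N) (b : Fin M), (a, b) ∈ T ∧ p = Sum.inl a ∧ q = Sum.inr b) :
              SimpleGraph (Fin N ⊕ Fin M)).IsAcyclic) ∧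
        (∀ i : Fin N, ∀ e : Fin N × Fin M,
          c * (if e.1 = i then 1 else 1 / (M : ℝ)) ≤
            ∑ ω : Fin (s + 1) → ((Fin N × Fin M) → Bool),
              (∏ t : Fin (s + 1), ∏ e' : Fin N × Fin M,
                  (if ω t e' = true then (if e'.1 = i then 1 else 1 / (M : ℝ))
                   else 1 - (if e'.1 = i then 1 else 1 / (M : ℝ)))) *
                ∑ T : Finset (Fin N × Fin M), (if e ∈ T then π ω T else 0)) := by
  classical
  obtain ⟨M, hMc⟩ := exists_nat_gt (2 / c)
  have hMpos : (0 : ℝ) < M := (by positivity : (0 : ℝ) < 2 / c).trans hMc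
  have hM : 0 < M := by exact_mod_cast hMpos
  have hcM : 2 < c * M := by rwa [div_lt_iff₀' hc0] at hMc
  set K : ℝ := ((M : ℝ) ^ M) ^ Fintype.card (Fin (s + 1)) with hK
  have hKpos : 0 < K := by positivity
  let N : ℕ := (M ^ M) ^ Fintype.card (Fin (s + 1)) * M
  have hN : 0 < N := by positivity
  have hNK : (N : ℝ) = K * M := by simp [N, hK]
  refine ⟨N, M, hN, hM, ?_⟩
  rintro ⟨π, hπ, hforest, hbal⟩
  let F (ω : Fin (s + 1) → Fin N × Fin M → Bool) : Finset (Fin N) :=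
    Finset.univ.filter fun i => ∀ t b, ω t (i, b) = true
  let P (ω : Fin (s + 1) → Fin N × Fin M → Bool) : ℝ :=
    ∏ t, ∏ e, (if ω t e = true then 1 / (M : ℝ) else 1 - 1 / (M : ℝ))
  have hP (ω) : 0 ≤ P ω := by
    have h1 : 1 / (M : ℝ) ≤ 1 := by
      rw [div_le_one hMpos]
      exact_mod_cast hM
    refine Finset.prod_nonneg fun t _ => Finset.prod_nonneg fun e _ => ?_
    split_ifs
    · positivity
    · linarith
  have hPsum : ∑ ω, P ω = 1 := sum_prod_bernoulli_eq_one _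
  have hFsum : ∑ ω, P ω * (K * (F ω).card) = N := by
    have h (i : Fin N) : ∑ ω : Fin (s + 1) → Fin N × Fin M → Bool,
        P ω * (if ∀ t b, ω t (i, b) = true then K else 0) = 1 := by
      rw [← sum_prod_bernoulli_eq_one (ι := Fin (s + 1))
        (fun e : Fin N × Fin M => if e.1 = i then 1 else 1 / (M : ℝ))]
      exact Finset.sum_congr rfl fun ω _ => (prod_bernoulli_row_eq hM i ω).symm
    calc ∑ ω, P ω * (K * (F ω).card)
        = ∑ ω, ∑ i : Fin N, P ω * (if ∀ t b, ω t (i, b) = true then K else 0) := by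
          refine Finset.sum_congr rfl fun ω _ => ?_
          rw [← Finset.mul_sum, ← Finset.sum_filter, Finset.sum_const, nsmul_eq_mul, mul_comm K]
      _ = N := by
          rw [Finset.sum_comm, Finset.sum_congr rfl fun i _ => h i]
          simp
  have hcount (ω) (T : Finset (Fin N × Fin M)) :
      π ω T * ((T.filter (fun e => e.1 ∈ F ω)).card : ℝ) ≤ π ω T * ((F ω).card + M) := by
    rcases ((hπ ω).1 T).eq_or_lt with h | h
    · simp [← h]
    · refine mul_le_mul_of_nonneg_left ?_ h.le
      exact_mod_cast card_filter_fst_mem_le_of_isAcyclic_s12 hM T (hforest ω T h).2 (F ω)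
  have hupper (ω) : ∑ i : Fin N, ∑ b : Fin M,
      P ω * (if ∀ t b, ω t (i, b) = true then K else 0) *
        ∑ T : Finset (Fin N × Fin M), (if (i, b) ∈ T then π ω T else 0) ≤
      P ω * (K * (F ω).card) + K * M * P ω := by
    have h1 : ∑ i : Fin N, ∑ b : Fin M,
        P ω * (if ∀ t b, ω t (i, b) = true then K else 0) *
          ∑ T : Finset (Fin N × Fin M), (if (i, b) ∈ T then π ω T else 0) =
        P ω * K * ∑ T, π ω T * ((T.filter (fun e => e.1 ∈ F ω)).card : ℝ) := by
      rw [← Fintype.sum_prod_type' (f := fun i b =>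
        P ω * (if ∀ t b, ω t (i, b) = true then K else 0) *
          ∑ T : Finset (Fin N × Fin M), (if (i, b) ∈ T then π ω T else 0))]
      simp_rw [Finset.mul_sum]
      rw [Finset.sum_comm]
      refine Finset.sum_congr rfl fun T _ => ?_
      rw [Finset.card_eq_sum_ones, Nat.cast_sum, Finset.mul_sum, Finset.mul_sum,
        Finset.sum_filter, ← Finset.sum_subset (Finset.subset_univ T)
          (fun e _ he => by simp [he])]
      refine Finset.sum_congr rfl fun e he => ?_
      simp only [F, Finset.mem_filter, Finset.mem_univ, true_and, he, if_true]
      split_ifs <;> simp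
    rw [h1]
    calc P ω * K * ∑ T, π ω T * ((T.filter (fun e => e.1 ∈ F ω)).card : ℝ)
        ≤ P ω * K * ∑ T, π ω T * ((F ω).card + M) :=
          mul_le_mul_of_nonneg_left (Finset.sum_le_sum fun T _ => hcount ω T)
            (mul_nonneg (hP ω) hKpos.le)
      _ = P ω * (K * (F ω).card) + K * M * P ω := by
          rw [← Finset.sum_mul, (hπ ω).2]
          ring
  have hlower : (N : ℝ) * (M * c) ≤ ∑ ω, ∑ i : Fin N, ∑ b : Fin M,
      P ω * (if ∀ t b, ω t (i, b) = true then K else 0) *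
        ∑ T : Finset (Fin N × Fin M), (if (i, b) ∈ T then π ω T else 0) := by
    rw [Finset.sum_comm]
    have h (i : Fin N) (b : Fin M) : c ≤ ∑ ω,
        P ω * (if ∀ t b, ω t (i, b) = true then K else 0) *
          ∑ T : Finset (Fin N × Fin M), (if (i, b) ∈ T then π ω T else 0) := by
      have := hbal i (i, b)
      simp_rw [prod_bernoulli_row_eq hM i] at this
      simpa only [if_true, mul_one] using this
    calc (N : ℝ) * (M * c) = ∑ i : Fin N, ∑ b : Fin M, c := by simp
      _ ≤ _ := Finset.sum_le_sum fun i _ => by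
          rw [Finset.sum_comm]
          exact Finset.sum_le_sum fun b _ => h i b
  have hfinal := hlower.trans (Finset.sum_le_sum fun ω _ => hupper ω)
  rw [Finset.sum_add_distrib, hFsum, ← Finset.mul_sum, hPsum, ← hNK] at hfinal
  have hNpos : (0 : ℝ) < N := by exact_mod_cast hN
  nlinarith
end

section
/- Let N ≥ 1 and M ≥ 2. Consider the bipartite graph G with left vertex set L = Fin N × Fin M and right vertex set R = Fin N ⊕ Fin (M−1), where (i, j) ∈ L is adjacent to inl i' iff i = i', and (i, j) is adjacent to inr k for every k ∈ Fin (M−1). For every i' ∈ Fin N and k ∈ Fin M, the set T = ({i'} × Fin M) ∪ (Fin N × {k}) admits a matching covering it: there exists an injective map φ : T → R such that every l ∈ T is adjacent to φ(l) in G. -/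
/-- In the bipartite graph defining the transversal matroid (left vertices
`L = Fin N × Fin M`, right vertices `R = Fin N ⊕ Fin (M-1)`, where `(i, j)` is adjacent
to `inl i'` iff `i = i'` and to every `inr k`), for every `i' : Fin N` and `k : Fin M`
the set `T = ({i'} × Fin M) ∪ (Fin N × {k})` admits a matching covering it: an injective
map `φ : T → R` sending each left vertex to a neighbour. -/
theorem stmt13 (N M : ℕ) (hN : 1 ≤ N) (hM : 2 ≤ M) (i' : Fin N) (k : Fin M) :
    ∃ φ : Fin N × Fin M → Fin N ⊕ Fin (M - 1),
      Set.InjOn φ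
        ↑((({i'} : Finset (Fin N)) ×ˢ (Finset.univ : Finset (Fin M))) ∪
          ((Finset.univ : Finset (Fin N)) ×ˢ ({k} : Finset (Fin M)))) ∧
      ∀ l ∈ (({i'} : Finset (Fin N)) ×ˢ (Finset.univ : Finset (Fin M))) ∪
          ((Finset.univ : Finset (Fin N)) ×ˢ ({k} : Finset (Fin M))),
        Sum.elim (fun i'' : Fin N => l.1 = i'') (fun _ : Fin (M - 1) => True) (φ l) := by
  obtain ⟨m, rfl⟩ : ∃ m, M = m + 1 := ⟨M - 1, by omega⟩
  refine ⟨fun l => (finSuccEquiv' k l.2).elim (Sum.inl l.1) Sum.inr, ?_, ?_⟩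
  · rintro ⟨a, b⟩ hab ⟨c, d⟩ hcd h
    simp only [Finset.mem_coe, Finset.mem_union, Finset.mem_product, Finset.mem_singleton,
      Finset.mem_univ, true_and, and_true] at hab hcd
    have hk (j : Fin (m + 1)) : finSuccEquiv' k j = none ↔ j = k := by
      rw [← finSuccEquiv'_at k, (finSuccEquiv' k).apply_eq_iff_eq]
    rcases hb : finSuccEquiv' k b with _ | x <;> rcases hd : finSuccEquiv' k d with _ | y <;>
      simp only [hb, hd, Option.elim_none, Option.elim_some, Sum.inl.injEq, Sum.inr.injEq,
        reduceCtorEq] at h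
    · rw [h, (hk b).1 hb, (hk d).1 hd]
    · have hbd : b = d := (finSuccEquiv' k).injective (by rw [hb, hd, h])
      have hbk : b ≠ k := fun e => by simp [(hk b).2 e] at hb
      have hdk : d ≠ k := hbd ▸ hbk
      rw [hab.resolve_right hbk, hcd.resolve_right hdk, hbd]
  · rintro ⟨a, b⟩ -
    cases h : finSuccEquiv' k b <;> simp [h]
end

section
/- For every c ∈ (0, 1] there exist integers N ≥ 1 and M ≥ 2 with the following property. Let L = Fin N × Fin M and R = Fin N ⊕ Fin (M−1), and let G be the bipartite graph in which (i, j) ∈ L is adjacent to inl i' iff i = i' and (i, j) is adjacent to inr k for every k. For i' ∈ Fin N define x^{i'} : L → ℝ by x^{i'}(i, j) = 1 if i = i' and 1/M otherwise. Then there is no function π from realizations ω : L → Bool to probability mass functions on Finset L such that: (feasibility) for every ω, every I in the support of π(ω) satisfies I ⊆ {l : ω l = true} and there exists an injective map φ : I → R with every l ∈ I adjacent to φ(l) in G; and (c-balancedness for every x^{i'}) for every i' ∈ Fin N and every l ∈ L, the probability that l ∈ I, when ω is drawn from the product of Bernoulli(x^{i'}(l')) distributions over l' ∈ L and then I is drawn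 from π(ω), is at least c · x^{i'}(l). -/
/-- The total mass of a product of Bernoulli distributions is one. -/
theorem sum_prod_bernoulli {α : Type*} [Fintype α] [DecidableEq α] (x : α → ℝ) :
    ∑ ω : α → Bool, ∏ a, (if ω a = true then x a else 1 - x a) = 1 := by
  rw [← Fintype.prod_sum (fun a (b : Bool) => if b = true then x a else 1 - x a)]
  simp

/-- The density of `x^{i}` with respect to the product of Bernoulli(`1/M`) distributions is
`M ^ M` times the indicator of the event that block `i` is fully active. -/
theorem prod_block_eq {N M : ℕ} (hM : (M : ℝ) ≠ 0) (i : Fin N) (ω : Fin N × Fin M → Bool) :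
    ∏ l : Fin N × Fin M, (if ω l = true then (if l.1 = i then 1 else 1 / (M : ℝ))
        else 1 - (if l.1 = i then 1 else 1 / (M : ℝ))) =
      (if ∀ j, ω (i, j) = true then 1 else 0) *
        ((M : ℝ) ^ M * ∏ l, (if ω l = true then 1 / (M : ℝ) else 1 - 1 / (M : ℝ))) := by
  split_ifs with h
  · have hK : (M : ℝ) ^ M = ∏ l : Fin N × Fin M, (if l.1 = i then (M : ℝ) else 1) := by
      rw [Fintype.prod_prod_type, Fintype.prod_eq_single i]
      · simp
      · intro a ha
        simp [ha]
    rw [one_mul, hK, ← Finset.prod_mul_distrib]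
    refine Finset.prod_congr rfl fun l _ => ?_
    by_cases hl : l.1 = i
    · have hω : ω l = true := by
        subst hl
        exact h l.2
      simp [hl, hω, hM]
    · simp [hl]
  · push Not at h
    obtain ⟨j, hj⟩ := h
    rw [zero_mul]
    exact Finset.prod_eq_zero (Finset.mem_univ (i, j)) (by simp [hj])

/-- An independent set has at most `#F + (M - 1)` elements in the blocks indexed by `F`. -/
theorem card_filter_le_of_matching {N M k : ℕ} (I : Finset (Fin N × Fin M)) (F : Finset (Fin N))
    (φ : Fin N × Fin M → Fin N ⊕ Fin k) (hinj : Set.InjOn φ ↑I)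
    (hadj : ∀ l ∈ I, Sum.elim (fun i : Fin N => l.1 = i) (fun _ : Fin k => True) (φ l)) :
    (I.filter (·.1 ∈ F)).card ≤ F.card + k := by
  have hcard : (F.disjSum (Finset.univ : Finset (Fin k))).card = F.card + k := by simp
  rw [← hcard]
  refine Finset.card_le_card_of_injOn φ (fun l hl => ?_)
    (hinj.mono (by exact_mod_cast Finset.filter_subset _ I))
  obtain ⟨hlI, hlF⟩ := Finset.mem_filter.1 hl
  have h := hadj l hlI
  rcases hφ : φ l with a | b
  · rw [hφ] at h
    have h' : l.1 = a := h
    simpa [← h'] using hlF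
  · simp

/-- The expected number of selected elements in the blocks indexed by `F` is at most any almost
sure bound. -/
theorem sum_blocks_le {N M : ℕ} (p : Finset (Fin N × Fin M) → ℝ) (F : Finset (Fin N)) (B : ℝ)
    (hp : ∀ I, 0 ≤ p I) (hsum : ∑ I, p I = 1)
    (hB : ∀ I, 0 < p I → ((I.filter (·.1 ∈ F)).card : ℝ) ≤ B) :
    ∑ l : Fin N × Fin M, (if l.1 ∈ F then 1 else 0) * ∑ I, (if l ∈ I then p I else 0) ≤ B := by
  calc _ = ∑ I, p I * (I.filter (·.1 ∈ F)).card := by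
        simp_rw [Finset.mul_sum]
        rw [Finset.sum_comm]
        refine Finset.sum_congr rfl fun I _ => ?_
        rw [Finset.card_filter, Nat.cast_sum, Finset.mul_sum, ← Finset.sum_filter_add_sum_filter_not
          Finset.univ (· ∈ I)]
        rw [Finset.sum_eq_zero (s := Finset.univ.filter (· ∉ I)), add_zero]
        · rw [Finset.filter_univ_mem]
          refine Finset.sum_congr rfl fun l hl => ?_
          simp [hl]
        · intro l hl
          simp [(Finset.mem_filter.1 hl).2]
    _ ≤ ∑ I, p I * B := by
        refine Finset.sum_le_sum fun I _ => ?_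
        rcases (hp I).eq_or_lt with h | h
        · simp [← h]
        · exact mul_le_mul_of_nonneg_left (hB I h) h.le
    _ = B := by rw [← Finset.sum_mul, hsum, one_mul]


/-- No oblivious `c`-balanced CRS exists for transversal matroids: for every `c ∈ (0, 1]`
there are `N ≥ 1` and `M ≥ 2` such that, for the transversal matroid on
`L = Fin N × Fin M` defined by the bipartite graph with right vertices
`R = Fin N ⊕ Fin (M-1)` (where `(i, j)` is adjacent to `inl i'` iff `i = i'`, and to
every `inr k`), and the ex ante vectors `x^{i'}` (equal to `1` on the block `i'` and
`1/M` elsewhere), no scheme `π` mapping realizations `ω : L → Bool` to probability mass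
functions on `Finset L` can always output an independent (matchable) subset of active
elements while accepting every element with probability at least `c · x^{i'}(l)` under
every `x^{i'}`. -/
theorem stmt15 (c : ℝ) (hc0 : 0 < c) (hc1 : c ≤ 1) :
    ∃ N M : ℕ, 1 ≤ N ∧ 2 ≤ M ∧
      ¬ ∃ π : ((Fin N × Fin M) → Bool) → (Finset (Fin N × Fin M) → ℝ),
        (∀ ω, (∀ I, 0 ≤ π ω I) ∧ ∑ I, π ω I = 1) ∧
        (∀ ω I, 0 < π ω I →
          (∀ l ∈ I, ω l = true) ∧
          ∃ φ : Fin N × Fin M → Fin N ⊕ Fin (M - 1),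
            Set.InjOn φ ↑I ∧
            ∀ l ∈ I,
              Sum.elim (fun i'' : Fin N => l.1 = i'') (fun _ : Fin (M - 1) => True) (φ l)) ∧
        (∀ i' : Fin N, ∀ l : Fin N × Fin M,
          c * (if l.1 = i' then 1 else 1 / (M : ℝ)) ≤
            ∑ ω : (Fin N × Fin M) → Bool,
              (∏ l' : Fin N × Fin M,
                  (if ω l' = true then (if l'.1 = i' then 1 else 1 / (M : ℝ))
                   else 1 - (if l'.1 = i' then 1 else 1 / (M : ℝ)))) *
                ∑ I : Finset (Fin N × Fin M), (if l ∈ I then π ω I else 0)) := by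
  obtain ⟨M₀, hM₀⟩ := exists_nat_ge (2 / c)
  obtain ⟨M, hM2, hMM₀⟩ : ∃ M : ℕ, 2 ≤ M ∧ M₀ ≤ M :=
    ⟨max 2 M₀, le_max_left _ _, le_max_right _ _⟩
  have hcM : 2 ≤ c * M := by
    have h : 2 / c ≤ (M : ℝ) := hM₀.trans (by exact_mod_cast hMM₀)
    rw [div_le_iff₀ hc0] at h
    linarith
  have hM0 : (0 : ℝ) < M := by exact_mod_cast (by omega : 0 < M)
  obtain ⟨N, hN⟩ : ∃ N : ℕ, N = M ^ M * M := ⟨_, rfl⟩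
  refine ⟨N, M, hN ▸ Nat.mul_pos (pow_pos (by omega) _) (by omega), hM2, ?_⟩
  rintro ⟨π, hπ, hfeas, hbal⟩
  set w : Fin N → (Fin N × Fin M → Bool) → ℝ := fun i ω =>
    ∏ l : Fin N × Fin M, (if ω l = true then (if l.1 = i then 1 else 1 / (M : ℝ))
        else 1 - (if l.1 = i then 1 else 1 / (M : ℝ)))
  set q : (Fin N × Fin M → Bool) → ℝ := fun ω =>
    ∏ l, (if ω l = true then 1 / (M : ℝ) else 1 - 1 / (M : ℝ))
  set a : (Fin N × Fin M → Bool) → Fin N × Fin M → ℝ := fun ω l =>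
    ∑ I : Finset (Fin N × Fin M), (if l ∈ I then π ω I else 0)
  have hw1 : ∀ i, ∑ ω, w i ω = 1 := fun i =>
    sum_prod_bernoulli (fun l : Fin N × Fin M => if l.1 = i then 1 else 1 / (M : ℝ))
  have hq1 : ∑ ω, q ω = 1 := sum_prod_bernoulli (fun _ : Fin N × Fin M => 1 / (M : ℝ))
  have hq0 : ∀ ω, 0 ≤ q ω := fun ω => Finset.prod_nonneg fun l _ => by
    have h : 1 / (M : ℝ) ≤ 1 := (div_le_one hM0).2 (by exact_mod_cast (by omega : 1 ≤ M))
    split_ifs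
    · positivity
    · linarith
  have hlower : (N : ℝ) * (M * c) ≤ ∑ l : Fin N × Fin M, ∑ ω, w l.1 ω * a ω l := by
    calc (N : ℝ) * (M * c) = ∑ _l : Fin N × Fin M, c := by
          simp [mul_assoc]
      _ ≤ _ := Finset.sum_le_sum fun l _ => by
        have h := hbal l.1 l
        rwa [if_pos rfl, mul_one] at h
  have hupper : ∀ ω, ∑ l : Fin N × Fin M, w l.1 ω * a ω l ≤
      ∑ i, w i ω + (M : ℝ) ^ M * (M - 1) * q ω := by
    intro ω
    set F : Finset (Fin N) := Finset.univ.filter fun i => ∀ j, ω (i, j) = true with hF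
    have hwF : ∀ i, w i ω = (if i ∈ F then 1 else 0) * ((M : ℝ) ^ M * q ω) := fun i => by
      simpa only [hF, Finset.mem_filter, Finset.mem_univ, true_and] using
        prod_block_eq hM0.ne' i ω
    have hle := sum_blocks_le (π ω) F (F.card + (M - 1)) (hπ ω).1 (hπ ω).2 fun I hI => by
      obtain ⟨-, φ, hinj, hadj⟩ := hfeas ω I hI
      have h := card_filter_le_of_matching I F φ hinj hadj
      have h' : ((I.filter (·.1 ∈ F)).card : ℝ) ≤ ((F.card + (M - 1) : ℕ) : ℝ) := by
        exact_mod_cast h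
      rwa [Nat.cast_add, Nat.cast_sub (by omega), Nat.cast_one] at h'
    calc ∑ l : Fin N × Fin M, w l.1 ω * a ω l
        = ((M : ℝ) ^ M * q ω) * ∑ l : Fin N × Fin M, (if l.1 ∈ F then 1 else 0) * a ω l := by
          rw [Finset.mul_sum]
          refine Finset.sum_congr rfl fun l _ => ?_
          rw [hwF]
          ring
      _ ≤ ((M : ℝ) ^ M * q ω) * (F.card + (M - 1)) :=
          mul_le_mul_of_nonneg_left hle (mul_nonneg (by positivity) (hq0 ω))
      _ = ∑ i, w i ω + (M : ℝ) ^ M * (M - 1) * q ω := by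
          simp_rw [hwF]
          rw [← Finset.sum_mul, Finset.sum_boole, Finset.filter_univ_mem]
          ring
  have htotal : (N : ℝ) * (M * c) ≤ N + (M : ℝ) ^ M * (M - 1) := by
    calc (N : ℝ) * (M * c) ≤ ∑ ω, ∑ l : Fin N × Fin M, w l.1 ω * a ω l := by
          rw [Finset.sum_comm]
          exact hlower
      _ ≤ ∑ ω, (∑ i, w i ω + (M : ℝ) ^ M * (M - 1) * q ω) :=
          Finset.sum_le_sum fun ω _ => hupper ω
      _ = N + (M : ℝ) ^ M * (M - 1) := by
          rw [Finset.sum_add_distrib, Finset.sum_comm, ← Finset.mul_sum, hq1]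
          simp [hw1]
  have hNR : (N : ℝ) = (M : ℝ) ^ M * M := by simp [hN]
  have hpow : (0 : ℝ) < (M : ℝ) ^ M := by positivity
  have hN2 : (N : ℝ) * 2 ≤ N * (M * c) :=
    mul_le_mul_of_nonneg_left (by linarith) (Nat.cast_nonneg _)
  nlinarith
end

section
/- Let n ≥ 1 and let x : Fin n → ℝ satisfy 0 ≤ x j ≤ 1 for all j and ∑_j x j ≤ 1. Define r : Fin n → ℝ by r i = (1/2) / (1 − (1/2) ∑_{j < i} x j), and define N : Fin (n+1) → ℝ by N 0 = 1 and N (i+1) = N i · (1 − x i · r i). Then for every i, N i = 1 − (1/2) ∑_{j < i} x j; in particular 0 ≤ x i · r i ≤ 1 for every i, and N i ≥ 1/2 for all i. -/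
theorem sum_filter_val_lt_succ {M : Type*} [AddCommMonoid M] {n : ℕ} (x : Fin n → M)
    (i : Fin n) :
    ∑ j ∈ Finset.univ.filter (fun j : Fin n => (j : ℕ) < (i : ℕ) + 1), x j =
      ∑ j ∈ Finset.univ.filter (fun j : Fin n => (j : ℕ) < (i : ℕ)), x j + x i := by
  have h : Finset.univ.filter (fun j : Fin n => (j : ℕ) < (i : ℕ) + 1) =
      insert i (Finset.univ.filter (fun j : Fin n => (j : ℕ) < (i : ℕ))) := by
    ext j
    simp only [Finset.mem_filter, Finset.mem_univ, true_and, Finset.mem_insert, Fin.ext_iff]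
    omega
  rw [h, Finset.sum_insert (by simp), add_comm]

/-- Invariant of the optimal non-oblivious single-item OCRS: with acceptance
probabilities `r i = (1/2) / (1 - (1/2) ∑_{j<i} x j)` and `N i` the probability that
nothing has been accepted when element `i` arrives (so `N 0 = 1` and
`N (i+1) = N i (1 - x i r i)`), one has `N i = 1 - (1/2) ∑_{j<i} x j`; in particular
`x i · r i ∈ [0, 1]` and `N i ≥ 1/2` for all `i`. -/
theorem stmt16 (n : ℕ) (hn : 1 ≤ n) (x : Fin n → ℝ)
    (hx0 : ∀ j, 0 ≤ x j) (hx1 : ∀ j, x j ≤ 1) (hsum : ∑ j, x j ≤ 1)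
    (r : Fin n → ℝ)
    (hr : ∀ i, r i = (1 / 2) / (1 - (1 / 2) * ∑ j ∈ Finset.Iio i, x j))
    (Nf : Fin (n + 1) → ℝ) (hN0 : Nf 0 = 1)
    (hNs : ∀ i : Fin n, Nf i.succ = Nf i.castSucc * (1 - x i * r i)) :
    (∀ i : Fin (n + 1),
        Nf i = 1 - (1 / 2) * ∑ j ∈ Finset.univ.filter (fun j : Fin n => (j : ℕ) < (i : ℕ)), x j) ∧
    (∀ i : Fin n, 0 ≤ x i * r i ∧ x i * r i ≤ 1) ∧
    (∀ i : Fin (n + 1), 1 / 2 ≤ Nf i) := by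
  set S : ℕ → ℝ := fun k => ∑ j ∈ Finset.univ.filter (fun j : Fin n => (j : ℕ) < k), x j with hS
  have S_le (k : ℕ) : S k ≤ 1 :=
    (Finset.sum_le_sum_of_subset_of_nonneg (Finset.filter_subset _ _)
      fun j _ _ => hx0 j).trans hsum
  have r_eq (i : Fin n) : r i = (1 / 2) / (1 - (1 / 2) * S i) := by
    have hIio : Finset.Iio i = Finset.univ.filter (fun j : Fin n => (j : ℕ) < i) := by
      ext j
      simp
    rw [hr, hIio]
  have invariant (i : Fin (n + 1)) : Nf i = 1 - (1 / 2) * S i := by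
    induction i using Fin.induction with
    | zero => simp [hN0, hS]
    | succ i ih =>
      have hden : 2 - S i ≠ 0 := by
        have := S_le i
        intro h
        linarith
      have hstep : S (i + 1) = S i + x i := sum_filter_val_lt_succ x i
      rw [hNs, ih, r_eq, Fin.val_succ, hstep, Fin.val_castSucc]
      field_simp
      ring
  refine ⟨invariant, fun i => ?_, fun i => ?_⟩
  · have hden : 0 < 1 - (1 / 2) * S i := by linarith [S_le i]
    rw [r_eq]
    refine ⟨mul_nonneg (hx0 i) (by positivity), ?_⟩
    rw [← mul_div_assoc, div_le_one hden]
    linarith [S_le i, hx1 i]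
  · rw [invariant]
    linarith [S_le i]
end
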